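/- arXiv:2201.00772 — 9 statements merged into one kernel-verified Lean document; each statement's English description precedes it below -/
import Mathlib

section
/- There exist a continuously differentiable function f : [0,1] → ℝ and a set M ⊂ graph f that is closed in ℝ² and nowhere dense in graph f (with the subspace topology) such that there does not exist any linearly continuous function g : ℝ² → ℝ which is discontinuous at each point of M. -/
/-- A function `g : ℝ² → ℝ` is linearly continuous if it is continuous on every line. -/
def LinearlyContinuous2 (g : ℝ × ℝ → ℝ) : Prop :=
  ∀ a v : ℝ × ℝ, Continuous fun t : ℝ => g (a + t • v)

open Set Filter Topology

/-- Continuous functions vanishing left of `0` and equal to `1` right of `1`. -/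
def UnitStep : Type :=
  {g : BoundedContinuousFunction ℝ ℝ // (∀ x ≤ 0, g x = 0) ∧ ∀ x, 1 ≤ x → g x = 1}

noncomputable instance : MetricSpace UnitStep :=
  inferInstanceAs (MetricSpace
    {g : BoundedContinuousFunction ℝ ℝ // (∀ x ≤ 0, g x = 0) ∧ ∀ x, 1 ≤ x → g x = 1})

instance : CompleteSpace UnitStep := by
  have hc : IsClosed {g : BoundedContinuousFunction ℝ ℝ |
      (∀ x ≤ 0, g x = 0) ∧ ∀ x, 1 ≤ x → g x = 1} := by
    have hev : ∀ x : ℝ, Continuous fun g : BoundedContinuousFunction ℝ ℝ => g x := fun x =>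
      continuous_eval_const x
    simp only [ofPred_and, ofPred_forall]
    exact (isClosed_iInter fun x => isClosed_iInter fun _ =>
      isClosed_eq (hev x) continuous_const).inter
      (isClosed_iInter fun x => isClosed_iInter fun _ => isClosed_eq (hev x) continuous_const)
  exact hc.completeSpace_coe

instance : Nonempty UnitStep := by
  refine ⟨⟨BoundedContinuousFunction.ofNormedAddCommGroup (fun x : ℝ => max 0 (min x 1))
    (by fun_prop) 1 fun x => ?_, fun x hx => ?_, fun x hx => ?_⟩⟩
  · rw [Real.norm_eq_abs, abs_of_nonneg (le_max_left _ _)]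
    exact max_le zero_le_one (min_le_right _ _)
  · show max 0 (min x 1) = 0
    exact max_eq_left ((min_le_left _ _).trans hx)
  · show max 0 (min x 1) = 1
    rw [min_eq_right hx, max_eq_right zero_le_one]

/-- The self-affine operator: up by `2/3`, down by `1/3`, constant, up by `2/3`, on the four
quarters of the unit interval. -/
noncomputable def selfAffine (g : UnitStep) : UnitStep := by
  refine ⟨BoundedContinuousFunction.ofNormedAddCommGroup
    (fun x : ℝ => 2 / 3 * g.1 (4 * x) - 1 / 3 * g.1 (4 * x - 1) + 2 / 3 * g.1 (4 * x - 3))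
    (by fun_prop) (2 * ‖g.1‖) fun x => ?_, fun x hx => ?_, fun x hx => ?_⟩
  · have h1 := g.1.norm_coe_le_norm (4 * x)
    have h2 := g.1.norm_coe_le_norm (4 * x - 1)
    have h3 := g.1.norm_coe_le_norm (4 * x - 3)
    rw [Real.norm_eq_abs, abs_le] at *
    constructor <;> linarith
  · show 2 / 3 * g.1 (4 * x) - 1 / 3 * g.1 (4 * x - 1) + 2 / 3 * g.1 (4 * x - 3) = 0
    rw [g.2.1 _ (by linarith), g.2.1 _ (by linarith), g.2.1 _ (by linarith)]
    norm_num
  · show 2 / 3 * g.1 (4 * x) - 1 / 3 * g.1 (4 * x - 1) + 2 / 3 * g.1 (4 * x - 3) = 1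
    rw [g.2.2 _ (by linarith), g.2.2 _ (by linarith), g.2.2 _ (by linarith)]
    norm_num

theorem selfAffine_apply (g : UnitStep) (x : ℝ) : (selfAffine g).1 x =
    2 / 3 * g.1 (4 * x) - 1 / 3 * g.1 (4 * x - 1) + 2 / 3 * g.1 (4 * x - 3) := rfl

theorem contractingWith_selfAffine : ContractingWith (2 / 3) selfAffine := by
  refine ⟨by rw [← NNReal.coe_lt_coe]; norm_num, LipschitzWith.of_dist_le_mul fun g k => ?_⟩
  show dist (selfAffine g).1 (selfAffine k).1 ≤ _ * dist g.1 k.1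
  rw [BoundedContinuousFunction.dist_le (by positivity)]
  intro x
  rw [selfAffine_apply, selfAffine_apply]
  have hd : ∀ y, |g.1 y - k.1 y| ≤ dist g.1 k.1 := fun y =>
    (Real.dist_eq _ _).symm.trans_le (BoundedContinuousFunction.dist_coe_le_dist y)
  have h0 : ∀ y ≤ 0, g.1 y - k.1 y = 0 := fun y hy => by rw [g.2.1 y hy, k.2.1 y hy, sub_self]
  have h1 : ∀ y, 1 ≤ y → g.1 y - k.1 y = 0 := fun y hy => by
    rw [g.2.2 y hy, k.2.2 y hy, sub_self]
  have d1 := abs_le.1 (hd (4 * x))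
  have d2 := abs_le.1 (hd (4 * x - 1))
  have d3 := abs_le.1 (hd (4 * x - 3))
  rw [Real.dist_eq, abs_le]
  push_cast
  rcases le_total (4 * x) 1 with hx | hx
  · have e2 := h0 (4 * x - 1) (by linarith)
    have e3 := h0 (4 * x - 3) (by linarith)
    constructor <;> linarith
  · have e1 := h1 _ hx
    rcases le_total (4 * x) 2 with hx' | hx'
    · have e3 := h0 (4 * x - 3) (by linarith)
      constructor <;> linarith
    · have e2 := h1 (4 * x - 1) (by linarith)
      constructor <;> linarith

theorem exists_selfAffine_fixedPoint : ∃ h : ℝ → ℝ, Continuous h ∧ (∀ x ≤ 0, h x = 0) ∧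
    (∀ x, 1 ≤ x → h x = 1) ∧
    ∀ x, h x = 2 / 3 * h (4 * x) - 1 / 3 * h (4 * x - 1) + 2 / 3 * h (4 * x - 3) := by
  obtain ⟨g, hg, -⟩ := contractingWith_selfAffine.exists_fixedPoint
    (Classical.arbitrary UnitStep) (edist_ne_top _ _)
  refine ⟨g.1, g.1.continuous, g.2.1, g.2.2, fun x => ?_⟩
  rw [← selfAffine_apply, hg]

/-- Between two points with different values there is an affine copy of `h` at every scale. -/
theorem exists_cylinder {h : ℝ → ℝ} (h0 : ∀ x ≤ 0, h x = 0) (h1 : ∀ x, 1 ≤ x → h x = 1)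
    (hh : ∀ x, h x = 2 / 3 * h (4 * x) - 1 / 3 * h (4 * x - 1) + 2 / 3 * h (4 * x - 3))
    (n : ℕ) : ∀ x y : ℝ, x ≤ y → h x ≠ h y →
    ∃ u α β : ℝ, 0 ≤ u ∧ u + (1 / 4) ^ n ≤ 1 ∧ u ≤ y ∧ x ≤ u + (1 / 4) ^ n ∧ α ≠ 0 ∧
      ∀ t ∈ Icc (0 : ℝ) 1, h (u + (1 / 4) ^ n * t) = α * h t + β := by
  induction n with
  | zero =>
    intro x y hxy hne
    refine ⟨0, 1, 0, le_rfl, by norm_num, ?_, ?_, one_ne_zero, fun t _ => by simp⟩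
    · by_contra! hy
      exact hne (by rw [h0 _ (hxy.trans hy.le), h0 _ hy.le])
    · by_contra! hx
      simp only [pow_zero, zero_add] at hx
      exact hne (by rw [h1 _ hx.le, h1 _ (hx.le.trans hxy)])
  | succ n ih =>
    intro x y hxy hne
    have key : ∀ j a b : ℝ, 0 ≤ j → j ≤ 3 → a ≠ 0 →
        (∀ s ∈ Icc (0 : ℝ) 1, h ((s + j) / 4) = a * h s + b) →
        h (4 * x - j) ≠ h (4 * y - j) → ∃ u α β : ℝ, 0 ≤ u ∧ u + (1 / 4) ^ (n + 1) ≤ 1 ∧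
          u ≤ y ∧ x ≤ u + (1 / 4) ^ (n + 1) ∧ α ≠ 0 ∧
          ∀ t ∈ Icc (0 : ℝ) 1, h (u + (1 / 4) ^ (n + 1) * t) = α * h t + β := by
      intro j a b hj hj' ha hab hne'
      obtain ⟨u, α, β, hu0, hu1, huy, hxu, hα, hu⟩ :=
        ih (4 * x - j) (4 * y - j) (by linarith) hne'
      have hδ : (0 : ℝ) < (1 / 4) ^ n := by positivity
      rw [pow_succ]
      refine ⟨(u + j) / 4, a * α, a * β + b, by positivity, by linarith, by linarith,
        by linarith, mul_ne_zero ha hα, fun t ht => ?_⟩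
      have hs : u + (1 / 4) ^ n * t ∈ Icc (0 : ℝ) 1 :=
        ⟨by have := mul_nonneg hδ.le ht.1; linarith,
          by have := mul_le_of_le_one_right hδ.le ht.2; linarith⟩
      have e : (u + j) / 4 + (1 / 4) ^ n * (1 / 4) * t = (u + (1 / 4) ^ n * t + j) / 4 := by ring
      rw [e, hab _ hs, hu t ht]
      ring
    by_cases e0 : h (4 * x - 0) = h (4 * y - 0)
    · by_cases e1 : h (4 * x - 1) = h (4 * y - 1)
      · refine key 3 (2 / 3) (1 / 3) (by norm_num) le_rfl (by norm_num) (fun s hs => ?_)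
          fun e3 => ?_
        · have e : 4 * ((s + 3) / 4) = s + 3 := by ring
          rw [hh, e, h1 (s + 3) (by linarith [hs.1]), h1 (s + 3 - 1) (by linarith [hs.1]),
            add_sub_cancel_right]
          ring
        · rw [sub_zero, sub_zero] at e0
          exact hne (by rw [hh x, hh y, e0, e1, e3])
      · refine key 1 (-1 / 3) (2 / 3) zero_le_one (by norm_num) (by norm_num) (fun s hs => ?_) e1
        have e : 4 * ((s + 1) / 4) = s + 1 := by ring
        rw [hh, e, h1 (s + 1) (by linarith [hs.1]), h0 (s + 1 - 3) (by linarith [hs.2]),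
          add_sub_cancel_right]
        ring
    · refine key 0 (2 / 3) 0 le_rfl (by norm_num) (by norm_num) (fun s hs => ?_) e0
      have e : 4 * ((s + 0) / 4) = s := by ring
      rw [hh, e, h0 (s - 1) (by linarith [hs.2]), h0 (s - 3) (by linarith [hs.2])]
      ring

theorem exists_cylinder_subset {h : ℝ → ℝ} (h0 : ∀ x ≤ 0, h x = 0) (h1 : ∀ x, 1 ≤ x → h x = 1)
    (hh : ∀ x, h x = 2 / 3 * h (4 * x) - 1 / 3 * h (4 * x - 1) + 2 / 3 * h (4 * x - 3))
    {a b x y : ℝ} (hx : x ∈ Ioo a b) (hy : y ∈ Ioo a b)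
    (hne : h x ≠ h y) : ∃ u δ α β : ℝ, 0 < δ ∧ 0 ≤ u ∧ u + δ ≤ 1 ∧ a < u ∧ u + δ < b ∧ α ≠ 0 ∧
      ∀ t ∈ Icc (0 : ℝ) 1, h (u + δ * t) = α * h t + β := by
  wlog hxy : x ≤ y generalizing x y
  · exact this hy hx hne.symm (le_of_not_ge hxy)
  obtain ⟨n, hn⟩ := exists_pow_lt_of_lt_one (lt_min (sub_pos.2 hx.1) (sub_pos.2 hy.2))
    (by norm_num : (1 / 4 : ℝ) < 1)
  obtain ⟨u, α, β, hu0, hu1, huy, hxu, hα, hu⟩ := exists_cylinder h0 h1 hh n x y hxy hne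
  have l := hn.trans_le (min_le_left _ _)
  have r := hn.trans_le (min_le_right _ _)
  exact ⟨u, _, α, β, by positivity, hu0, hu1, by linarith, by linarith, hα, hu⟩

/-- A continuous function, `0` left of `0` and `1` right of `1`, which is constant on a dense family of
intervals but oscillates on every interval where it is not constant. -/
theorem exists_oscillating_function : ∃ h : ℝ → ℝ, Continuous h ∧ (∀ x ≤ 0, h x = 0) ∧
    (∀ x, 1 ≤ x → h x = 1) ∧ ∀ a b x y : ℝ, x ∈ Ioo a b → y ∈ Ioo a b → h x ≠ h y →
      (∃ c d, 0 ≤ c ∧ d ≤ 1 ∧ a < c ∧ c < d ∧ d < b ∧ ∀ z ∈ Icc c d, h z = h c) ∧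
      ∃ r s t v, a < r ∧ r < s ∧ s < t ∧ t < b ∧
        (h r < v ∧ v < h s ∧ h t < v ∨ v < h r ∧ h s < v ∧ v < h t) := by
  obtain ⟨h, hc, h0, h1, hh⟩ := exists_selfAffine_fixedPoint
  have hq : h (1 / 4) = 2 / 3 := by
    rw [hh, h1 _ (by norm_num), h0 _ (by norm_num), h0 _ (by norm_num)]; norm_num
  have hg : ∀ z ∈ Icc (1 / 2 : ℝ) (3 / 4), h z = 1 / 3 := fun z hz => by
    rw [hh, h1 _ (by linarith [hz.1]), h1 _ (by linarith [hz.1]), h0 _ (by linarith [hz.2])]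
    norm_num
  refine ⟨h, hc, h0, h1, fun a b x y hx hy hne => ?_⟩
  obtain ⟨u, δ, α, β, hδ, hu0, hu1, hau, hub, hα, hu⟩ := exists_cylinder_subset h0 h1 hh hx hy hne
  have hu2 : ∀ z ∈ Icc (1 / 2 : ℝ) (3 / 4), h (u + δ * z) = α * (1 / 3) + β := fun z hz => by
    rw [hu z ⟨by linarith [hz.1], by linarith [hz.2]⟩, hg z hz]
  refine ⟨⟨u + δ * (1 / 2), u + δ * (3 / 4), by linarith, by linarith, by linarith, by linarith, by linarith,
    fun z hz => ?_⟩, u + δ * 0, u + δ * (1 / 4), u + δ * (1 / 2), α * (1 / 2) + β, by linarith,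
    by linarith, by linarith, by linarith, ?_⟩
  · have e : z = u + δ * ((z - u) / δ) := by field_simp; ring
    rw [e, hu2 _ ⟨?_, ?_⟩, hu2 _ ⟨le_rfl, by norm_num⟩]
    · rw [le_div_iff₀ hδ]; linarith [hz.1]
    · rw [div_le_iff₀ hδ]; linarith [hz.2]
  · rw [hu 0 ⟨le_rfl, zero_le_one⟩, hu (1 / 4) ⟨by norm_num, by norm_num⟩,
      hu2 (1 / 2) ⟨le_rfl, by norm_num⟩, hq, h0 0 le_rfl]
    rcases hα.lt_or_gt with hα | hα
    · right; refine ⟨?_, ?_, ?_⟩ <;> linarith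
    · left; refine ⟨?_, ?_, ?_⟩ <;> linarith

theorem exists_first_hit {F : ℝ → ℝ} (hF : Continuous F) {p q k : ℝ} (hpq : p < q)
    (hp : F p < k) (hq : k < F q) :
    ∃ x ∈ Ioo p q, F x = k ∧ ¬ ∀ᶠ y in 𝓝 x, F y = k := by
  have hcpt : IsCompact (Icc p q ∩ F ⁻¹' {k}) :=
    isCompact_Icc.inter_right (isClosed_singleton.preimage hF)
  have hne : (Icc p q ∩ F ⁻¹' {k}).Nonempty := by
    obtain ⟨x, hx, hxk⟩ := intermediate_value_Icc hpq.le hF.continuousOn ⟨hp.le, hq.le⟩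
    exact ⟨x, hx, hxk⟩
  obtain ⟨x, ⟨hx, hxk : F x = k⟩, hleast⟩ := hcpt.exists_isLeast hne
  have hpx : p < x := hx.1.lt_of_ne fun e => by rw [← e] at hxk; linarith
  have hxq : x < q := hx.2.lt_of_ne fun e => by rw [e] at hxk; linarith
  refine ⟨x, ⟨hpx, hxq⟩, hxk, fun hev => ?_⟩
  obtain ⟨y, hyk, hpy, hyx⟩ := ((hev.filter_mono nhdsWithin_le_nhds).and
    (Ioo_mem_nhdsLT hpx)).exists
  exact absurd (hleast ⟨⟨hpy.le, hyx.le.trans hx.2⟩, hyk⟩) (not_le.2 hyx)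

theorem exists_hit_of_ne {F : ℝ → ℝ} (hF : Continuous F) {p q k : ℝ}
    (hp : F p < k) (hq : k < F q) :
    ∃ x ∈ uIcc p q, F x = k ∧ ¬ ∀ᶠ y in 𝓝 x, F y = k := by
  rcases lt_trichotomy p q with hpq | rfl | hpq
  · obtain ⟨x, hx, h⟩ := exists_first_hit hF hpq hp hq
    exact ⟨x, Icc_subset_uIcc (Ioo_subset_Icc_self hx), h⟩
  · exact absurd (hp.trans hq) (lt_irrefl _)
  · obtain ⟨x, hx, h⟩ := exists_first_hit hF.neg hpq (neg_lt_neg hq) (neg_lt_neg hp)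
    simp only [Pi.neg_apply, neg_inj] at h
    exact ⟨x, Icc_subset_uIcc' (Ioo_subset_Icc_self hx), h⟩

theorem exists_tangent_lt {f h : ℝ → ℝ} (hf : ∀ x, HasDerivAt f (h x) x) (hc : Continuous h)
    {a b : ℝ} (hab : a < b) (hlt : h a < h b) :
    ∃ p ∈ Icc a b, f p + h p * (b - p) < f b := by
  obtain ⟨p, hp, hmin⟩ := isCompact_Icc.exists_isMinOn (nonempty_Icc.2 hab.le) hc.continuousOn
  have hpb : h p < h b := (hmin (left_mem_Icc.2 hab.le)).trans_lt hlt
  have hpb' : p < b := hp.2.lt_of_ne fun e => by rw [e] at hpb; exact lt_irrefl _ hpb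
  refine ⟨p, hp, ?_⟩
  have := intervalIntegral.integral_lt_integral_of_continuousOn_of_le_of_exists_lt hpb'
    (f := fun _ => h p) continuousOn_const hc.continuousOn
    (fun x hx => hmin ⟨hp.1.trans hx.1.le, hx.2⟩) ⟨b, right_mem_Icc.2 hpb'.le, hpb⟩
  rw [intervalIntegral.integral_eq_sub_of_hasDerivAt (fun x _ => hf x)
    (hc.intervalIntegrable _ _), intervalIntegral.integral_const, smul_eq_mul] at this
  linarith

theorem exists_tangent_gt {f h : ℝ → ℝ} (hf : ∀ x, HasDerivAt f (h x) x) (hc : Continuous h)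
    {a b : ℝ} (hab : a < b) (hlt : h b < h a) :
    ∃ q ∈ Icc a b, f b < f q + h q * (b - q) := by
  obtain ⟨q, hq, h⟩ := exists_tangent_lt (f := -f) (h := -h) (fun x => (hf x).neg) hc.neg hab
    (neg_lt_neg hlt)
  simp only [Pi.neg_apply] at h
  exact ⟨q, hq, by linarith⟩

/-- The points at which `h` is not locally constant. -/
def varyingSet (h : ℝ → ℝ) : Set ℝ := {x | ¬ ∀ᶠ y in 𝓝 x, h y = h x}

theorem isClosed_varyingSet (h : ℝ → ℝ) : IsClosed (varyingSet h) := by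
  rw [← isOpen_compl_iff, isOpen_iff_mem_nhds]
  intro x hx
  have hx : ∀ᶠ y in 𝓝 x, h y = h x := not_not.1 hx
  filter_upwards [hx.eventually_nhds, hx] with y hy hyx
  exact not_not.2 (hy.mono fun z hz => hz.trans hyx.symm)

/-- The tangent line of `f` at `x` has a locally constant height at `m` off `varyingSet h`. -/
theorem eventually_tangent_eq {f h : ℝ → ℝ} (hf : ∀ x, HasDerivAt f (h x) x) {x : ℝ}
    (hx : x ∉ varyingSet h) (m : ℝ) :
    ∀ᶠ y in 𝓝 x, f y + h y * (m - y) = f x + h x * (m - x) := by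
  have hx : ∀ᶠ y in 𝓝 x, h y = h x := not_not.1 hx
  obtain ⟨ε, hε, hball⟩ := Metric.eventually_nhds_iff_ball.1 hx
  have hconst : ∀ y ∈ Metric.ball x ε, f y - h x * y = f x - h x * x := by
    intro y hy
    refine (convex_ball x ε).is_const_of_fderivWithin_eq_zero (𝕜 := ℝ)
      (f := fun y => f y - h x * y) ?_ ?_ hy (Metric.mem_ball_self hε)
    · exact fun z _ => ((hf z).sub ((hasDerivAt_id z).const_mul (h x))).differentiableAt
        |>.differentiableWithinAt
    · intro z hz
      have := ((hf z).sub ((hasDerivAt_id z).const_mul (h x)))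
      rw [hball z hz, mul_one, sub_self] at this
      have := this.hasFDerivAt
      rw [fderivWithin_of_isOpen Metric.isOpen_ball hz]
      refine this.fderiv.trans ?_
      ext; simp
  filter_upwards [Metric.ball_mem_nhds x hε] with y hy
  rw [hball y hy]
  linarith [hconst y hy]

theorem exists_tangents_around {f h : ℝ → ℝ} (hf : ∀ x, HasDerivAt f (h x) x)
    (hc : Continuous h) {a b r s t v : ℝ} (har : a < r) (hrs : r < s) (hst : s < t) (htb : t < b)
    (hv : h r < v ∧ v < h s ∧ h t < v ∨ v < h r ∧ h s < v ∧ v < h t) :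
    ∃ x ∈ varyingSet h, x ∈ Ioo a b ∧ ∃ p ∈ Ioo a b, ∃ q ∈ Ioo a b,
      f p + h p * (x - p) < f x ∧ f x < f q + h q * (x - q) := by
  rcases hv with ⟨h1, h2, h3⟩ | ⟨h1, h2, h3⟩
  · obtain ⟨x, hx, hxv, hev⟩ := exists_first_hit hc.neg hst (neg_lt_neg h2) (neg_lt_neg h3)
    simp only [Pi.neg_apply, neg_inj] at hxv hev
    obtain ⟨p, hp, hpx⟩ := exists_tangent_lt hf hc (hrs.trans hx.1) (by rwa [hxv])
    obtain ⟨q, hq, hqx⟩ := exists_tangent_gt hf hc hx.1 (by rwa [hxv])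
    refine ⟨x, ?_, ⟨?_, ?_⟩, p, ⟨?_, ?_⟩, q, ⟨?_, ?_⟩, hpx, hqx⟩
    · rwa [varyingSet, mem_ofPred_eq, hxv]
    all_goals linarith [hx.1, hx.2, hp.1, hp.2, hq.1, hq.2]
  · obtain ⟨x, hx, hxv, hev⟩ := exists_first_hit hc hst h2 h3
    obtain ⟨q, hq, hqx⟩ := exists_tangent_gt hf hc (hrs.trans hx.1) (by rwa [hxv])
    obtain ⟨p, hp, hpx⟩ := exists_tangent_lt hf hc hx.1 (by rwa [hxv])
    refine ⟨x, ?_, ⟨?_, ?_⟩, p, ⟨?_, ?_⟩, q, ⟨?_, ?_⟩, hpx, hqx⟩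
    · rwa [varyingSet, mem_ofPred_eq, hxv]
    all_goals linarith [hx.1, hx.2, hp.1, hp.2, hq.1, hq.2]

/-- Points near which `g` stays `3 * η`-far from `c` somewhere, while `g` is `2 * η`-close to `c`
on a punctured segment of the tangent line. -/
def tangentSet (g : ℝ × ℝ → ℝ) (f h : ℝ → ℝ) (c η δ : ℝ) : Set ℝ :=
  {x | (∃ᶠ z in 𝓝 (x, f x), 3 * η ≤ |g z - c|) ∧
    ∀ t, t ≠ 0 → |t| < δ → |g (x + t, f x + h x * t) - c| ≤ 2 * η}

theorem exists_mem_tangentSet {g : ℝ × ℝ → ℝ} (hg : LinearlyContinuous2 g) (f h : ℝ → ℝ) {x : ℝ}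
    (hx : ¬ ContinuousAt g (x, f x)) :
    ∃ (c : ℚ) (n k : ℕ), x ∈ tangentSet g f h c (1 / (n + 1)) (1 / (k + 1)) := by
  rw [Metric.continuousAt_iff'] at hx
  push Not at hx
  obtain ⟨ε, hε, hfreq⟩ := hx
  obtain ⟨n, hn⟩ := exists_nat_one_div_lt (show 0 < ε / 4 by positivity)
  have hη : (0 : ℝ) < 1 / (n + 1) := by positivity
  obtain ⟨c, hc, hc'⟩ := exists_rat_btwn
    (show g (x, f x) - 1 / ((n : ℝ) + 1) < g (x, f x) by linarith)
  have ht : ContinuousAt (fun t : ℝ => g (x + t, f x + h x * t)) 0 := by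
    have := (hg (x, f x) (1, h x)).continuousAt (x := 0)
    simpa [mul_comm] using this
  have hev := Metric.continuousAt_iff.1 ht _ hη
  obtain ⟨δ, hδ, hev⟩ := hev
  obtain ⟨k, hk⟩ := exists_nat_one_div_lt hδ
  refine ⟨c, n, k, hfreq.mono fun z hz => ?_, fun t _ htk => ?_⟩
  · rw [Real.dist_eq] at hz
    have h1 := abs_sub_le (g z) c (g (x, f x))
    have h2 : |(c : ℝ) - g (x, f x)| ≤ 1 / (n + 1) := abs_le.2 ⟨by linarith, by linarith⟩
    linarith
  · have := hev (x := t) (by rw [Real.dist_eq, sub_zero]; exact htk.trans hk)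
    simp only [Real.dist_eq, add_zero, mul_zero] at this
    have h1 := abs_lt.1 this
    exact abs_le.2 ⟨by linarith, by linarith⟩

theorem not_subset_closure_tangentSet {g : ℝ × ℝ → ℝ} (hg : LinearlyContinuous2 g)
    {f h : ℝ → ℝ} (hf : ∀ x, HasDerivAt f (h x) x) (hc : Continuous h)
    (hosc : ∀ a b x, x ∈ varyingSet h → x ∈ Ioo a b →
      ∃ x ∈ varyingSet h, x ∈ Ioo a b ∧ ∃ p ∈ Ioo a b, ∃ q ∈ Ioo a b,
        f p + h p * (x - p) < f x ∧ f x < f q + h q * (x - q))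
    {c η δ : ℝ} (hη : 0 < η) (hδ : 0 < δ) {U : Set ℝ} (hU : IsOpen U)
    (hne : (varyingSet h ∩ U).Nonempty) :
    ¬ varyingSet h ∩ U ⊆ closure (tangentSet g f h c η δ) := by
  intro hsub
  have hfc : Continuous f := continuous_iff_continuousAt.2 fun x => (hf x).continuousAt
  obtain ⟨y, hyC, hyU⟩ := hne
  obtain ⟨ε, hε, hball⟩ := Metric.isOpen_iff.1 hU y hyU
  set r := min ε (δ / 2) with hr
  have hr0 : 0 < r := by positivity
  have hIU : Ioo (y - r) (y + r) ⊆ U := by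
    rw [← Real.ball_eq_Ioo]
    exact (Metric.ball_subset_ball (min_le_left _ _)).trans hball
  obtain ⟨x₀, hx₀C, hx₀, p, hp, q, hq, hpx, hqx⟩ :=
    hosc (y - r) (y + r) y hyC ⟨by linarith, by linarith⟩
  -- near `(x₀, f x₀)`, the tangents at `p` and `q` pass below and above
  have hnear : ∀ᶠ z : ℝ × ℝ in 𝓝 (x₀, f x₀), f p + h p * (z.1 - p) < z.2 ∧
      z.2 < f q + h q * (z.1 - q) ∧ z.1 ∈ Ioo (y - r) (y + r) := by
    refine Filter.Eventually.and ?_ (Filter.Eventually.and ?_ ?_)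
    · exact (isOpen_lt (by fun_prop) continuous_snd).mem_nhds hpx
    · exact (isOpen_lt continuous_snd (by fun_prop)).mem_nhds hqx
    · exact (isOpen_Ioo.preimage continuous_fst).mem_nhds hx₀
  have hgraph : Tendsto (fun x => (x, f x)) (𝓝 x₀) (𝓝 (x₀, f x₀)) :=
    (continuous_id.prodMk hfc).continuousAt
  obtain ⟨x₁, hx₁, hx₁S⟩ := mem_closure_iff_frequently.1 (hsub ⟨hx₀C, hIU hx₀⟩)
    |>.and_eventually (hgraph.eventually hnear.eventually_nhds) |>.exists
  obtain ⟨⟨m, k₀⟩, hfar, hk₀⟩ := (hx₁.1.and_eventually hx₁S).exists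
  -- move the far point vertically off the graph
  have hvert : Continuous fun k => g (m, k) := by
    have := (hg (m, 0) (0, 1))
    simpa using this
  have hkev : ∀ᶠ k in 𝓝 k₀, 2 * η < |g (m, k) - c| ∧
      (f p + h p * (m - p) < k ∧ k < f q + h q * (m - q)) :=
    Filter.Eventually.and
      ((isOpen_lt continuous_const (hvert.sub continuous_const).abs).mem_nhds
        (show 2 * η < |g (m, k₀) - c| by linarith))
      (Ioo_mem_nhds hk₀.1 hk₀.2.1)
  have hkne : ∃ᶠ k in 𝓝 k₀, k ≠ f m := by
    intro hev
    simp only [ne_eq, not_not] at hev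
    obtain ⟨k, hk, hkk⟩ := ((hev.filter_mono nhdsWithin_le_nhds).and
      (self_mem_nhdsWithin : {k₀}ᶜ ∈ 𝓝[≠] k₀)).exists
    exact hkk (hk.trans hev.self_of_nhds.symm)
  obtain ⟨k, hkm, hkfar, hpk, hkq⟩ := (hkne.and_eventually hkev).exists
  have hψ : Continuous fun x => f x + h x * (m - x) := by fun_prop
  obtain ⟨x, hx, hxk, hxC⟩ := exists_hit_of_ne hψ hpk hkq
  have hxC : x ∈ varyingSet h := by
    by_contra hx'
    refine hxC ((eventually_tangent_eq hf hx' m).mono fun y hy => hy.trans hxk)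
  have hxI : x ∈ Ioo (y - r) (y + r) := ordConnected_Ioo.uIcc_subset hp hq hx
  have hxm : x ≠ m := by
    rintro rfl
    exact hkm (by rw [← hxk]; simp)
  have hev : ∀ᶠ x' in 𝓝 x, x' ≠ m ∧ x' ∈ Ioo (y - r) (y + r) ∧
      2 * η < |g (m, f x' + h x' * (m - x')) - c| := by
    refine Filter.Eventually.and (isOpen_ne.mem_nhds hxm)
      (Filter.Eventually.and (isOpen_Ioo.mem_nhds hxI) ?_)
    refine (isOpen_lt continuous_const ((hvert.comp hψ).sub continuous_const).abs).mem_nhds ?_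
    show 2 * η < |g (m, f x + h x * (m - x)) - c|
    rwa [hxk]
  obtain ⟨x', hx', hx'm, hx'I, hx'far⟩ := (mem_closure_iff_frequently.1 (hsub ⟨hxC, hIU hxI⟩)
    |>.and_eventually hev).exists
  have hmI := hk₀.2.2
  have hr2 : r ≤ δ / 2 := min_le_right _ _
  have := hx'.2 (m - x') (sub_ne_zero.2 hx'm.symm)
    (abs_lt.2 ⟨by linarith [hmI.1, hx'I.2], by linarith [hmI.2, hx'I.1]⟩)
  rw [add_sub_cancel] at this
  linarith

theorem exists_continuousAt_graph {g : ℝ × ℝ → ℝ} (hg : LinearlyContinuous2 g)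
    {f h : ℝ → ℝ} (hf : ∀ x, HasDerivAt f (h x) x) (hc : Continuous h)
    (hosc : ∀ a b x, x ∈ varyingSet h → x ∈ Ioo a b →
      ∃ x ∈ varyingSet h, x ∈ Ioo a b ∧ ∃ p ∈ Ioo a b, ∃ q ∈ Ioo a b,
        f p + h p * (x - p) < f x ∧ f x < f q + h q * (x - q))
    (hne : (varyingSet h).Nonempty) : ∃ x ∈ varyingSet h, ContinuousAt g (x, f x) := by
  by_contra! hdisc
  have : CompleteSpace (varyingSet h) := (isClosed_varyingSet h).completeSpace_coe
  have : Nonempty (varyingSet h) := hne.to_subtype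
  let S : ℚ × ℕ × ℕ → Set ℝ := fun i =>
    closure (tangentSet g f h i.1 (1 / (i.2.1 + 1)) (1 / (i.2.2 + 1)))
  have hcover : ⋃ i, ((↑) : varyingSet h → ℝ) ⁻¹' S i = univ := by
    refine eq_univ_of_forall fun x => mem_iUnion.2 ?_
    obtain ⟨c, n, k, hx⟩ := exists_mem_tangentSet hg f h (hdisc x x.2)
    exact ⟨(c, n, k), subset_closure hx⟩
  obtain ⟨⟨c, n, k⟩, x, hx⟩ := nonempty_interior_of_iUnion_of_closed
    (fun i => isClosed_closure.preimage continuous_subtype_val) hcover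
  obtain ⟨V, hV, hVo, hxV⟩ := mem_interior.1 hx
  obtain ⟨U, hU, rfl⟩ := isOpen_induced_iff.1 hVo
  exact not_subset_closure_tangentSet hg hf hc hosc (by positivity) (by positivity) hU
    ⟨x, x.2, hxV⟩ fun z hz => hV (show (⟨z, hz.1⟩ : varyingSet h) ∈ _ from hz.2)

/-- There exist a `C¹` function `f` on `[0,1]` and a set `M ⊆ graph f`, closed in `ℝ²` and
nowhere dense in `graph f`, such that no linearly continuous function on `ℝ²` is
discontinuous at every point of `M`. -/
theorem stmt_0 :
    ∃ (f f' : ℝ → ℝ),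
      (∀ x ∈ Set.Icc (0:ℝ) 1, HasDerivWithinAt f (f' x) (Set.Icc (0:ℝ) 1) x) ∧
      ContinuousOn f' (Set.Icc (0:ℝ) 1) ∧
      ∃ M : Set (ℝ × ℝ),
        M ⊆ {p : ℝ × ℝ | p.1 ∈ Set.Icc (0:ℝ) 1 ∧ p.2 = f p.1} ∧
        IsClosed M ∧
        IsNowhereDense
          ((Subtype.val ⁻¹' M) : Set {p : ℝ × ℝ | p.1 ∈ Set.Icc (0:ℝ) 1 ∧ p.2 = f p.1}) ∧
        ¬ ∃ g : ℝ × ℝ → ℝ, LinearlyContinuous2 g ∧ ∀ p ∈ M, ¬ ContinuousAt g p := by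
  obtain ⟨h, hc, h0, h1, hh⟩ := exists_oscillating_function
  obtain ⟨f, hf⟩ : ∃ f : ℝ → ℝ, ∀ x, HasDerivAt f (h x) x :=
    ⟨fun x => ∫ t in (0 : ℝ)..x, h t, fun x => hc.integral_hasStrictDerivAt 0 x |>.hasDerivAt⟩
  have hfc : Continuous f := continuous_iff_continuousAt.2 fun x => (hf x).continuousAt
  have hvary : ∀ a b x, x ∈ varyingSet h → x ∈ Ioo a b → ∃ y ∈ Ioo a b, h x ≠ h y := by
    intro a b x hx hxI
    by_contra! hall
    exact hx (by filter_upwards [isOpen_Ioo.mem_nhds hxI] with y hy using (hall y hy).symm)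
  have hsub : varyingSet h ⊆ Icc 0 1 := by
    intro x hx
    by_contra hx'
    rw [mem_Icc, not_and_or, not_le, not_le] at hx'
    rcases hx' with hx' | hx'
    · exact hx (by
        filter_upwards [Iio_mem_nhds hx'] with y hy
        rw [h0 _ hx'.le, h0 _ (le_of_lt hy)])
    · exact hx (by
        filter_upwards [Ioi_mem_nhds hx'] with y hy
        rw [h1 _ hx'.le, h1 _ (le_of_lt hy)])
  have hMclosed : IsClosed {p : ℝ × ℝ | p.1 ∈ varyingSet h ∧ p.2 = f p.1} :=
    ((isClosed_varyingSet h).preimage continuous_fst).inter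
      (isClosed_eq continuous_snd (hfc.comp continuous_fst))
  refine ⟨f, h, fun x _ => (hf x).hasDerivWithinAt, hc.continuousOn,
    {p | p.1 ∈ varyingSet h ∧ p.2 = f p.1}, fun p hp => ⟨hsub hp.1, hp.2⟩, hMclosed, ?_, ?_⟩
  · rw [(hMclosed.preimage continuous_subtype_val).isNowhereDense_iff,
      eq_empty_iff_forall_notMem]
    rintro ⟨⟨x, y⟩, hxI : x ∈ Icc (0 : ℝ) 1, hy : y = f x⟩ hx
    subst hy
    let γ : Icc (0 : ℝ) 1 → {p : ℝ × ℝ | p.1 ∈ Icc (0 : ℝ) 1 ∧ p.2 = f p.1} :=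
      fun t => ⟨(t, f t), t.2, rfl⟩
    have hγ : Continuous γ := by
      refine Continuous.subtype_mk ?_ _
      exact continuous_subtype_val.prodMk (hfc.comp continuous_subtype_val)
    have hnhds : ∀ᶠ t : Icc (0 : ℝ) 1 in 𝓝 ⟨x, hxI⟩, (t : ℝ) ∈ varyingSet h := by
      filter_upwards [hγ.continuousAt.preimage_mem_nhds (mem_interior_iff_mem_nhds.1 hx)]
        with t ht using ht.1
    rw [nhds_subtype_eq_comap, eventually_comap] at hnhds
    obtain ⟨ε, hε, hball⟩ := Metric.eventually_nhds_iff_ball.1 hnhds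
    rw [Real.ball_eq_Ioo] at hball
    have hxC : x ∈ varyingSet h := hnhds.self_of_nhds ⟨x, hxI⟩ rfl
    have hxε : x ∈ Ioo (x - ε) (x + ε) := ⟨by linarith, by linarith⟩
    obtain ⟨y, hy, hxy⟩ := hvary _ _ x hxC hxε
    obtain ⟨c, d, hc0, hd1, hac, hcd, hdb, hconst⟩ := (hh _ _ x y hxε hy hxy).1
    have hz : (c + d) / 2 ∈ Ioo c d := ⟨by linarith, by linarith⟩
    refine hball ((c + d) / 2) ⟨by linarith [hz.1], by linarith [hz.2]⟩
      ⟨(c + d) / 2, by linarith [hz.1], by linarith [hz.2]⟩ rfl ?_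
    filter_upwards [isOpen_Ioo.mem_nhds hz] with w hw
    rw [hconst w (Ioo_subset_Icc_self hw), hconst _ (Ioo_subset_Icc_self hz)]
  · rintro ⟨g, hg, hdisc⟩
    have hne : (varyingSet h).Nonempty := by
      obtain ⟨x, -, hx, hev⟩ := exists_first_hit hc (p := 0) (q := 1) (k := 1 / 2) zero_lt_one
        (by rw [h0 0 le_rfl]; norm_num) (by rw [h1 1 le_rfl]; norm_num)
      exact ⟨x, by rwa [varyingSet, mem_ofPred_eq, hx]⟩
    obtain ⟨x, hx, hcont⟩ := exists_continuousAt_graph hg hf hc (fun a b x hx hxI => by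
      obtain ⟨y, hy, hxy⟩ := hvary a b x hx hxI
      obtain ⟨r, s, t, v, har, hrs, hst, htb, hv⟩ := (hh a b x y hxI hy hxy).2
      exact exists_tangents_around hf hc har hrs hst htb hv) hne
    exact hdisc (x, f x) ⟨hx, rfl⟩ hcont
end

section
/- Let f ∈ C¹[0,1], let P ⊂ (0,1) be a nonempty perfect nowhere dense set, and let D ⊂ P be a countable dense subset of P. Suppose that for each d ∈ D two points u_d, v_d ∈ (0,1) are given such that u_d < v_d < d, the point (d, f(d)) lies in the interior (in ℝ²) of T_{f, [u_d,v_d] ∩ P}, and for each ε > 0 the set {d ∈ D : d − u_d > ε} is finite. Then there does not exist any linearly continuous function g : ℝ² → ℝ which is discontinuous at each point of the set graph(f|_P) = {(x, f(x)) : x ∈ P}. -/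
/-- For `f ∈ C¹[0,1]` and `Z ⊆ [0,1]`, the union of tangent lines to `graph f`
at points `(z, f z)` with `z ∈ Z`. -/
def TangentUnion (f f' : ℝ → ℝ) (Z : Set ℝ) : Set (ℝ × ℝ) :=
  {p : ℝ × ℝ | ∃ z ∈ Z, p.2 = f z + f' z * (p.1 - z)}

/-- Baire category theorem on a nonempty closed set of reals covered by countably many sets. -/
lemma exists_ball_subset_closure_of_countable_cover {ι : Type*} [Countable ι] {P : Set ℝ}
    (hP : IsClosed P) (hne : P.Nonempty) (A : ι → Set ℝ) (hA : P ⊆ ⋃ i, A i) :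
    ∃ i, ∃ x ∈ P, ∃ r > 0, ∀ y ∈ P, |y - x| < r → y ∈ closure (P ∩ A i) := by
  have : CompleteSpace P := hP.completeSpace_coe
  have : Nonempty P := hne.to_subtype
  obtain ⟨i, x, hx⟩ := nonempty_interior_of_iUnion_of_closed
    (f := fun i => closure ((Subtype.val : P → ℝ) ⁻¹' A i)) (fun i => isClosed_closure) (by
      refine Set.eq_univ_of_forall fun x => ?_
      obtain ⟨i, hi⟩ := Set.mem_iUnion.1 (hA x.2)
      exact Set.mem_iUnion.2 ⟨i, subset_closure hi⟩)
  obtain ⟨r, hr, hball⟩ := Metric.isOpen_iff.1 isOpen_interior x hx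
  refine ⟨i, x, x.2, r, hr, fun y hy hyr => ?_⟩
  have hy' : (⟨y, hy⟩ : P) ∈ closure ((Subtype.val : P → ℝ) ⁻¹' A i) :=
    interior_subset (hball (by simpa [Subtype.dist_eq, Real.dist_eq] using hyr))
  have := image_closure_subset_closure_image continuous_subtype_val (Set.mem_image_of_mem _ hy')
  simpa [Subtype.image_preimage_coe] using this

lemma LinearlyContinuous2.continuous_left {g : ℝ × ℝ → ℝ} (hg : LinearlyContinuous2 g) (y : ℝ) :
    Continuous fun x => g (x, y) := by
  simpa using hg (0, y) (1, 0)

lemma LinearlyContinuous2.continuous_right {g : ℝ × ℝ → ℝ} (hg : LinearlyContinuous2 g) (x : ℝ) :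
    Continuous fun y => g (x, y) := by
  simpa using hg (x, 0) (0, 1)

/-- Separately continuous functions on the plane are quasi-continuous. -/
lemma exists_isOpen_subset_of_separately_continuous {g : ℝ × ℝ → ℝ}
    (hl : ∀ y, Continuous fun x => g (x, y)) (hr : ∀ x, Continuous fun y => g (x, y))
    {O : Set (ℝ × ℝ)} (hO : IsOpen O) {q : ℝ × ℝ} (hq : q ∈ O) {η : ℝ} (hη : 0 < η) :
    ∃ V ⊆ O, IsOpen V ∧ V.Nonempty ∧ ∀ p ∈ V, |g p - g q| < η := by
  obtain ⟨a, b⟩ := q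
  obtain ⟨ρ, hρ, hρO⟩ := Metric.isOpen_iff.1 hO _ hq
  obtain ⟨σ, hσ, hσg⟩ := Metric.continuous_iff.1 (hl b) a (η / 3) (by positivity)
  set δ := min ρ σ / 2 with hδ
  have hδ0 : 0 < δ := by positivity
  have hδρ : δ < ρ := by have := min_le_left ρ σ; have := lt_min hρ hσ; linarith
  have hδσ : δ < σ := by have := min_le_right ρ σ; have := lt_min hρ hσ; linarith
  obtain ⟨n, x, hx, r, hr0, hcl⟩ := exists_ball_subset_closure_of_countable_cover
    (P := Set.Icc (a - δ) (a + δ)) isClosed_Icc (Set.nonempty_Icc.2 (by linarith))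
    (fun n : ℕ => {x | ∀ y, |y - b| < 1 / ((n : ℝ) + 1) → |g (x, y) - g (x, b)| < η / 3})
    (by
      intro x _
      obtain ⟨τ, hτ, hτg⟩ := Metric.continuous_iff.1 (hr x) b (η / 3) (by positivity)
      obtain ⟨n, hn⟩ := exists_nat_one_div_lt hτ
      exact Set.mem_iUnion.2 ⟨n, fun y hy => hτg y (hy.trans hn)⟩)
  have hn : 0 < 1 / ((n : ℝ) + 1) := Nat.one_div_pos_of_nat
  refine ⟨(Metric.ball x r ∩ Set.Ioo (a - δ) (a + δ)) ×ˢ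
    Metric.ball b (min ρ (1 / ((n : ℝ) + 1))), ?_, ?_, ?_, ?_⟩
  · rintro ⟨s, t⟩ ⟨⟨-, hs⟩, ht⟩
    apply hρO
    rw [Metric.mem_ball, Prod.dist_eq, max_lt_iff]
    refine ⟨?_, lt_of_lt_of_le ht (min_le_left _ _)⟩
    rw [Real.dist_eq, abs_lt]
    constructor <;> linarith [hs.1, hs.2]
  · exact (Metric.isOpen_ball.inter isOpen_Ioo).prod Metric.isOpen_ball
  · refine Set.Nonempty.prod ?_ ⟨b, Metric.mem_ball_self (lt_min hρ hn)⟩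
    rw [← closure_Ioo (by linarith)] at hx
    exact mem_closure_iff.1 hx _ Metric.isOpen_ball (Metric.mem_ball_self hr0)
  · rintro ⟨s, t⟩ ⟨⟨hs, hs'⟩, ht⟩
    have hmem := hcl s (Set.Ioo_subset_Icc_self hs') hs
    have hclosed : IsClosed {s | |g (s, t) - g (a, b)| ≤ 2 * η / 3} :=
      isClosed_le ((hl t).sub continuous_const).abs continuous_const
    have hle := closure_minimal (t := {s | |g (s, t) - g (a, b)| ≤ 2 * η / 3}) (by
      rintro w ⟨hw, hwA⟩
      have h1 := hwA t (lt_of_lt_of_le ht (min_le_right _ _))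
      have h2 : |g (w, b) - g (a, b)| < η / 3 := hσg w (by
        rw [Real.dist_eq, abs_lt]
        constructor <;> linarith [hw.1, hw.2])
      have h3 := abs_sub_le (g (w, t)) (g (w, b)) (g (a, b))
      simp only [Set.mem_ofPred_eq]
      linarith) hclosed hmem
    simp only [Set.mem_ofPred_eq] at hle
    linarith

/-- Removing finitely many points from a dense subset of a perfect set keeps it dense. -/
lemma Perfect.exists_mem_ball_notMem_finite {P D S : Set ℝ} (hP : Perfect P)
    (hD : P ⊆ closure D) (hS : S.Finite) {x r : ℝ} (hx : x ∈ P) (hr : 0 < r) :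
    ∃ d ∈ D, |d - x| < r ∧ d ∉ S := by
  obtain ⟨y, ⟨⟨hyb, hyS⟩, hyP⟩, hyx⟩ := accPt_iff_nhds.1 (hP.acc x hx)
    (Metric.ball x r ∩ (S \ {x})ᶜ)
    ((Metric.isOpen_ball.inter (hS.subset Set.sdiff_subset).isClosed.isOpen_compl).mem_nhds
      ⟨Metric.mem_ball_self hr, by simp⟩)
  have hyS' : y ∉ S := fun h => hyS ⟨h, hyx⟩
  obtain ⟨d, ⟨hd, hdS⟩, hdD⟩ := mem_closure_iff.1 (hD hyP) (Metric.ball x r ∩ Sᶜ)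
    (Metric.isOpen_ball.inter hS.isClosed.isOpen_compl) ⟨hyb, hyS'⟩
  exact ⟨d, hdD, hd, hdS⟩

theorem stmt_1 (f f' : ℝ → ℝ)
    (hderiv : ∀ x ∈ Set.Icc (0:ℝ) 1, HasDerivWithinAt f (f' x) (Set.Icc (0:ℝ) 1) x)
    (hcont : ContinuousOn f' (Set.Icc (0:ℝ) 1))
    (P : Set ℝ) (hP1 : P ⊆ Set.Ioo (0:ℝ) 1) (hPne : P.Nonempty)
    (hPperf : Perfect P) (hPnd : IsNowhereDense P)
    (D : Set ℝ) (hD : D ⊆ P) (hDcount : D.Countable) (hDdense : P ⊆ closure D)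
    (u v : ℝ → ℝ)
    (huv : ∀ d ∈ D, u d ∈ Set.Ioo (0:ℝ) 1 ∧ v d ∈ Set.Ioo (0:ℝ) 1 ∧ u d < v d ∧ v d < d)
    (hint : ∀ d ∈ D,
      ((d, f d) : ℝ × ℝ) ∈ interior (TangentUnion f f' (Set.Icc (u d) (v d) ∩ P)))
    (hfin : ∀ ε > (0:ℝ), {d ∈ D | d - u d > ε}.Finite) :
    ¬ ∃ g : ℝ × ℝ → ℝ, LinearlyContinuous2 g ∧ ∀ x ∈ P, ¬ ContinuousAt g (x, f x) := by
  rintro ⟨g, hg, hdisc⟩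
  have hf : ∀ x ∈ P, ContinuousAt f x := fun x hx =>
    ((hderiv x (Set.Ioo_subset_Icc_self (hP1 hx))).hasDerivAt
      (Icc_mem_nhds (hP1 hx).1 (hP1 hx).2)).continuousAt
  have hf' : ∀ x ∈ P, ContinuousAt f' x := fun x hx =>
    hcont.continuousAt (Icc_mem_nhds (hP1 hx).1 (hP1 hx).2)
  obtain ⟨⟨n, m, c⟩, x₀, hx₀, r, hr, hcl⟩ := exists_ball_subset_closure_of_countable_cover
    hPperf.closed hPne
    (fun i : ℕ × ℕ × ℚ => {x | (∀ O : Set (ℝ × ℝ), IsOpen O → (x, f x) ∈ O →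
        ∃ q ∈ O, ∃ q' ∈ O, 1 / ((i.1 : ℝ) + 1) ≤ |g q - g q'|) ∧
      ∀ t, |t| < 1 / ((i.2.1 : ℝ) + 1) →
        |g (x + t, f x + f' x * t) - i.2.2| < 1 / ((i.1 : ℝ) + 1) / 4})
    (by
      intro x hx
      have hd := hdisc x hx
      rw [Metric.continuousAt_iff] at hd
      push Not at hd
      obtain ⟨ε, hε, hosc⟩ := hd
      obtain ⟨n, hn⟩ := exists_nat_one_div_lt hε
      have hn0 : 0 < 1 / ((n : ℝ) + 1) := Nat.one_div_pos_of_nat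
      obtain ⟨c, hc, hc'⟩ := exists_rat_btwn
        (show g (x, f x) < g (x, f x) + 1 / ((n : ℝ) + 1) / 8 by linarith)
      obtain ⟨τ, hτ, hτg⟩ := Metric.continuous_iff.1 (hg (x, f x) (1, f' x)) 0
        (1 / ((n : ℝ) + 1) / 8) (by positivity)
      obtain ⟨m, hm⟩ := exists_nat_one_div_lt hτ
      refine Set.mem_iUnion.2 ⟨(n, m, c), fun O hO hxO => ?_, fun t ht => ?_⟩
      · obtain ⟨ρ, hρ, hρO⟩ := Metric.isOpen_iff.1 hO _ hxO
        obtain ⟨q, hq, hgq⟩ := hosc ρ hρ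
        exact ⟨q, hρO hq, _, hxO, hn.le.trans hgq⟩
      · have h := hτg t (by simpa using ht.trans hm)
        simp only [Real.dist_eq, Prod.smul_mk, smul_eq_mul, mul_one, Prod.mk_add_mk, zero_mul,
          add_zero, mul_comm t, one_mul] at h
        rw [abs_lt] at h ⊢
        constructor <;> dsimp only <;> linarith [h.1, h.2])
  have hε : 0 < 1 / ((n : ℝ) + 1) := Nat.one_div_pos_of_nat
  have hδ : 0 < 1 / ((m : ℝ) + 1) := Nat.one_div_pos_of_nat
  dsimp only at hcl
  set ε := 1 / ((n : ℝ) + 1)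
  set δ := 1 / ((m : ℝ) + 1)
  obtain ⟨d, hdD, hdx, hdS⟩ := hPperf.exists_mem_ball_notMem_finite hDdense
    (hfin (min (r / 2) (δ / 2)) (by positivity)) hx₀ (half_pos hr)
  have hdu : d - u d ≤ min (r / 2) (δ / 2) := not_lt.1 fun h => hdS ⟨hdD, h⟩
  obtain ⟨hdur, hduδ⟩ := le_min_iff.1 hdu
  have hdP := hD hdD
  set O := interior (TangentUnion f f' (Set.Icc (u d) (v d) ∩ P)) ∩
    Metric.ball (d, f d) (δ / 2) with hOdef
  have hO : IsOpen O := isOpen_interior.inter Metric.isOpen_ball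
  have hdO : (d, f d) ∈ O := ⟨hint d hdD, Metric.mem_ball_self (half_pos hδ)⟩
  obtain ⟨q, hqO, hqc⟩ : ∃ q ∈ O, ε / 2 ≤ |g q - c| := by
    obtain ⟨y, hyO, -, hy, -⟩ := mem_closure_iff_nhds.1 (hcl d hdP (by linarith)) _
      ((continuousAt_id.prodMk (hf d hdP)).preimage_mem_nhds (hO.mem_nhds hdO))
    obtain ⟨q, hq, q', hq', hqq⟩ := hy O hO hyO
    have h := abs_sub_le (g q) c (g q')
    rw [abs_sub_comm (c : ℝ)] at h
    by_contra! hlt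
    linarith [hlt q hq, hlt q' hq']
  obtain ⟨V, hVO, hV, ⟨p, hpV⟩, hVg⟩ := exists_isOpen_subset_of_separately_continuous
    hg.continuous_left hg.continuous_right hO hqO (show 0 < ε / 4 by positivity)
  obtain ⟨hpT, hpd⟩ := hVO hpV
  obtain ⟨z, ⟨⟨huz, hzv⟩, hzP⟩, hpz⟩ := interior_subset hpT
  obtain ⟨-, -, -, hvd⟩ := huv d hdD
  have hpd' : |p.1 - d| < δ / 2 := by
    rw [Metric.mem_ball, Prod.dist_eq, max_lt_iff] at hpd
    exact hpd.1
  rw [abs_lt] at hpd' hdx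
  have hpzδ : |p.1 - z| < δ := abs_lt.2 ⟨by linarith, by linarith⟩
  have hzcl := hcl z hzP (abs_lt.2 ⟨by linarith, by linarith⟩)
  have hV' : ∀ᶠ y in nhds z, (p.1, f y + f' y * (p.1 - y)) ∈ V :=
    (continuousAt_const.prodMk ((hf z hzP).add
      ((hf' z hzP).mul (continuousAt_const.sub continuousAt_id)))).preimage_mem_nhds
      (hV.mem_nhds (by simpa [← hpz] using hpV))
  have hδ' : ∀ᶠ y in nhds z, |p.1 - y| < δ :=
    (continuousAt_const.sub continuousAt_id).abs.eventually_lt continuousAt_const hpzδ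
  obtain ⟨y, ⟨hyV, hyδ⟩, -, -, hy⟩ := mem_closure_iff_nhds.1 hzcl _ (hV'.and hδ')
  have h1 := hy _ hyδ
  rw [add_sub_cancel] at h1
  have h2 := hVg _ hyV
  have h3 := abs_sub_le (g q) (g (p.1, f y + f' y * (p.1 - y))) c
  rw [abs_sub_comm (g q) (g (p.1, _))] at h3
  linarith
end

section
/- Let G, G̃ ∈ C¹[0,1] with g := G' and g̃ := G̃'. Let real numbers 0 < u < z < v < x < 1, y ∈ ℝ, and ε > 0, δ > 0, η > 0 satisfy: v + δ + η < x, v − u < η, 6η < ε·δ; (x, y) ∈ T_{G,z}; sup_{t∈[0,1]} |G(t) − G̃(t)| ≤ η; sup_{t∈[0,1]} |g(t)| ≤ 1 and |g(s) − g(t)| ≤ η for all s, t ∈ [u,v]; and there exist u < s₁ < s₂ < v with g̃(s₁) = g(s₁) − ε and g̃(s₂) = g(s₂) + ε. Then the open Euclidean ball B((x,y), η) in ℝ² is contained in T_{G̃, (u,v)}. -/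
/-- The open Euclidean ball in `ℝ²` with center `(x, y)` and radius `r`. -/
def EuclBall (x y r : ℝ) : Set (ℝ × ℝ) :=
  {p : ℝ × ℝ | (p.1 - x) ^ 2 + (p.2 - y) ^ 2 < r ^ 2}

theorem stmt_2 (G Gt g gt : ℝ → ℝ)
    (hG : ∀ t ∈ Set.Icc (0:ℝ) 1, HasDerivWithinAt G (g t) (Set.Icc (0:ℝ) 1) t)
    (hgc : ContinuousOn g (Set.Icc (0:ℝ) 1))
    (hGt : ∀ t ∈ Set.Icc (0:ℝ) 1, HasDerivWithinAt Gt (gt t) (Set.Icc (0:ℝ) 1) t)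
    (hgtc : ContinuousOn gt (Set.Icc (0:ℝ) 1))
    (u z v x y ε δ η : ℝ)
    (h0u : 0 < u) (huz : u < z) (hzv : z < v) (hvx : v < x) (hx1 : x < 1)
    (hε : 0 < ε) (hδ : 0 < δ) (hη : 0 < η)
    (h1 : v + δ + η < x) (h2 : v - u < η) (h3 : 6 * η < ε * δ)
    (hTan : y = G z + g z * (x - z))
    (hGGt : ∀ t ∈ Set.Icc (0:ℝ) 1, |G t - Gt t| ≤ η)
    (hgbd : ∀ t ∈ Set.Icc (0:ℝ) 1, |g t| ≤ 1)
    (hosc : ∀ s ∈ Set.Icc u v, ∀ t ∈ Set.Icc u v, |g s - g t| ≤ η)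
    (hs : ∃ s₁ s₂ : ℝ, u < s₁ ∧ s₁ < s₂ ∧ s₂ < v ∧
      gt s₁ = g s₁ - ε ∧ gt s₂ = g s₂ + ε) :
    EuclBall x y η ⊆ TangentUnion Gt gt (Set.Ioo u v) := by
  intro p hp
  obtain ⟨s₁, s₂, hs1, hs12, hs2, e1, e2⟩ := hs
  obtain ⟨a, b⟩ := p
  simp only [EuclBall, Set.mem_ofPred_eq] at hp
  have ha : |a - x| < η := abs_lt_of_sq_lt_sq (by nlinarith [sq_nonneg (b - y)]) hη.le
  have hb : |b - y| < η := abs_lt_of_sq_lt_sq (by nlinarith [sq_nonneg (a - x)]) hη.le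
  have error_bound : ∀ s ∈ Set.Ioo u v, |Gt s + g s * (a - s) - b| ≤ 6 * η ∧ δ < a - s := by
    intro s hs
    have hs' : s ∈ Set.Icc (0:ℝ) 1 := ⟨by linarith [hs.1], by linarith [hs.2]⟩
    have hz' : z ∈ Set.Icc (0:ℝ) 1 := ⟨by linarith, by linarith⟩
    have hsz : |s - z| ≤ η := abs_le.2 ⟨by linarith [hs.1], by linarith [hs.2]⟩
    have hGsz : |G s - G z| ≤ 1 * |s - z| :=
      (convex_Icc (0:ℝ) 1).norm_image_sub_le_of_norm_hasDerivWithin_le hG hgbd hz' hs'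
    have hgsz := hosc s ⟨hs.1.le, hs.2.le⟩ z ⟨huz.le, hzv.le⟩
    have hslope : |(g s - g z) * (x - z)| ≤ η := by
      rw [abs_mul, abs_of_pos (by linarith : 0 < x - z)]
      nlinarith
    have hshift : |g s * ((a - x) - (s - z))| ≤ 2 * η := by
      rw [abs_mul]
      have := abs_sub (a - x) (s - z)
      nlinarith [hgbd s hs', abs_nonneg (g s), abs_nonneg ((a - x) - (s - z))]
    have hapx := hGGt s hs'
    have heq : Gt s + g s * (a - s) - b = -(G s - Gt s) + (G s - G z) + (g s - g z) * (x - z)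
        + g s * ((a - x) - (s - z)) - (b - y) := by
      rw [hTan]; ring
    rw [heq]
    rw [one_mul] at hGsz
    have hGsz' := hGsz.trans hsz
    rw [abs_le] at hapx hGsz' hslope hshift ⊢
    rw [abs_lt] at ha hb
    refine ⟨⟨?_, ?_⟩, ?_⟩ <;> linarith [hs.2]
  have hsub : Set.Icc s₁ s₂ ⊆ Set.Icc (0:ℝ) 1 :=
    Set.Icc_subset_Icc (by linarith) (by linarith)
  have hcont : ContinuousOn (fun s => Gt s + gt s * (a - s)) (Set.Icc s₁ s₂) := by
    have hGtc : ContinuousOn Gt (Set.Icc s₁ s₂) := fun t ht =>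
      (hGt t (hsub ht)).continuousWithinAt.mono hsub
    have := hgtc.mono hsub
    fun_prop
  have hmem : b ∈ Set.Icc (Gt s₁ + gt s₁ * (a - s₁)) (Gt s₂ + gt s₂ * (a - s₂)) := by
    obtain ⟨k1, d1⟩ := error_bound s₁ ⟨hs1, by linarith⟩
    obtain ⟨k2, d2⟩ := error_bound s₂ ⟨by linarith, hs2⟩
    rw [abs_le] at k1 k2
    rw [e1, e2]
    constructor
    · nlinarith [mul_lt_mul_of_pos_left d1 hε]
    · nlinarith [mul_lt_mul_of_pos_left d2 hε]
  obtain ⟨t, ht, hbt⟩ := intermediate_value_Icc hs12.le hcont hmem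
  exact ⟨t, ⟨by linarith [ht.1], by linarith [ht.2]⟩, hbt.symm⟩
end

section
/- Suppose f ∈ C¹[0,1] and f' has infinite total variation on an interval [α, β] ⊂ [0,1] (i.e. f' is not of bounded variation on [α, β]). Then there exist numbers e, w with α < e < w < β such that (w, f(w)) ∈ T_{f,e}, i.e. f(w) = f(e) + f'(e)(w − e). -/
open Set in
/-- If the graph of `f` lies strictly above each tangent line to the right of the point of
tangency, then the derivative of `f` is monotone. -/
theorem monotoneOn_of_forward_tangent_lt {f f' : ℝ → ℝ} {α β : ℝ}
    (hf : ∀ x ∈ Ioo α β, HasDerivAt f (f' x) x)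
    (h : ∀ e w, α < e → e < w → w < β → f e + f' e * (w - e) < f w) :
    MonotoneOn f' (Ioo α β) := by
  intro a ha b hb hab
  rcases hab.eq_or_lt with rfl | hab
  · rfl
  have hg : ∀ x ∈ Icc a b, HasDerivAt (fun x ↦ f x - f' a * x) (f' x - f' a) x := by
    intro x hx
    have hx' : x ∈ Ioo α β := ⟨ha.1.trans_le hx.1, hx.2.trans_lt hb.2⟩
    exact (hf x hx').fun_sub (hasDerivAt_const_mul (f' a))
  obtain ⟨c, hc, hmax⟩ := isCompact_Icc.exists_isMaxOn (nonempty_Icc.2 hab.le)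
    (fun x hx ↦ (hg x hx).continuousAt.continuousWithinAt)
  have hcb_le : f b - f' a * b ≤ f c - f' a * c := hmax (right_mem_Icc.2 hab.le)
  have hac : a < c := by
    refine hc.1.lt_of_ne ?_
    rintro rfl
    linarith [h a b ha.1 hab hb.2]
  have hcb : c = b := by
    by_contra hne
    have hlt : c < b := hc.2.lt_of_ne hne
    have hzero := (hmax.isLocalMax (Icc_mem_nhds hac hlt)).hasDerivAt_eq_zero (hg c hc)
    have hlt' := h c b (ha.1.trans hac) hlt hb.2
    rw [sub_eq_zero.1 hzero] at hlt'
    linarith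
  subst hcb
  have hcone : a - c ∈ posTangentConeAt (Icc a c) c :=
    sub_mem_posTangentConeAt_of_segment_subset (by rw [segment_symm, segment_eq_Icc hab.le])
  have hle := hmax.localize.hasFDerivWithinAt_nonpos
    (hg c hc).hasDerivWithinAt.hasFDerivWithinAt hcone
  simp at hle
  nlinarith

open Set in
theorem MonotoneOn.Icc_of_Ioo {g : ℝ → ℝ} {α β : ℝ} (hαβ : α < β)
    (hg : MonotoneOn g (Ioo α β)) (hc : ContinuousOn g (Icc α β)) :
    MonotoneOn g (Icc α β) := by
  have hcl : closure (Ioo α β) = Icc α β := closure_Ioo hαβ.ne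
  have hα := left_mem_Icc.2 hαβ.le
  have hβ := right_mem_Icc.2 hαβ.le
  rw [← Ioc_insert_left hαβ.le]
  rw [← Ioo_insert_right hαβ]
  refine (hg.insert_of_continuousWithinAt ?_ ?_).insert_of_continuousWithinAt ?_ ?_
  · exact mem_closure_iff_clusterPt.1 (hcl ▸ hβ)
  · exact (hc β hβ).mono Ioo_subset_Icc_self
  · exact mem_closure_iff_clusterPt.1
      (closure_mono (subset_insert _ _) (hcl ▸ hα))
  · exact (hc α hα).mono (by rw [Ioo_insert_right hαβ]; exact Ioc_subset_Icc_self)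

open Set in
theorem boundedVariationOn_of_forward_tangent_lt {f f' : ℝ → ℝ} {α β : ℝ} (hαβ : α < β)
    (hf : ∀ x ∈ Ioo α β, HasDerivAt f (f' x) x) (hc : ContinuousOn f' (Icc α β))
    (h : ∀ e w, α < e → e < w → w < β → f e + f' e * (w - e) < f w) :
    BoundedVariationOn f' (Icc α β) := by
  have hm := (monotoneOn_of_forward_tangent_lt hf h).Icc_of_Ioo hαβ hc
  simpa using hm.locallyBoundedVariationOn α β (left_mem_Icc.2 hαβ.le) (right_mem_Icc.2 hαβ.le)

open Set in
theorem isPreconnected_ordered_pairs (α β : ℝ) :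
    IsPreconnected {p : ℝ × ℝ | α < p.1 ∧ p.1 < p.2 ∧ p.2 < β} := by
  refine Convex.isPreconnected fun p hp q hq a b ha hb hab ↦ ?_
  obtain ⟨hp₁, hp₂, hp₃⟩ := hp
  obtain ⟨hq₁, hq₂, hq₃⟩ := hq
  simp only [mem_ofPred_eq, Prod.fst_add, Prod.snd_add, Prod.smul_fst, Prod.smul_snd, smul_eq_mul]
  obtain rfl : b = 1 - a := by linarith
  refine ⟨?_, ?_, ?_⟩ <;> rcases ha.eq_or_lt with rfl | ha' <;> nlinarith

theorem stmt_4 (f f' : ℝ → ℝ)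
    (hf : ∀ x ∈ Set.Icc (0:ℝ) 1, HasDerivWithinAt f (f' x) (Set.Icc (0:ℝ) 1) x)
    (hfc : ContinuousOn f' (Set.Icc (0:ℝ) 1))
    (α β : ℝ) (hαβ : α < β) (hsub : Set.Icc α β ⊆ Set.Icc (0:ℝ) 1)
    (hvar : ¬ BoundedVariationOn f' (Set.Icc α β)) :
    ∃ e w : ℝ, α < e ∧ e < w ∧ w < β ∧ f w = f e + f' e * (w - e) := by
  by_contra! hne
  have hc : ContinuousOn f' (Set.Icc α β) := hfc.mono hsub
  have hd : ∀ x ∈ Set.Ioo α β, HasDerivAt f (f' x) x := fun x hx ↦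
    (hf x (hsub (Set.Ioo_subset_Icc_self hx))).hasDerivAt
      (Filter.mem_of_superset (Icc_mem_nhds hx.1 hx.2) hsub)
  have hfco : ContinuousOn f (Set.Ioo α β) := fun x hx ↦
    (hd x hx).continuousAt.continuousWithinAt
  have hf'co : ContinuousOn f' (Set.Ioo α β) := hc.mono Set.Ioo_subset_Icc_self
  set S : Set (ℝ × ℝ) := {p | α < p.1 ∧ p.1 < p.2 ∧ p.2 < β}
  have h₁ : Set.MapsTo Prod.fst S (Set.Ioo α β) := fun p hp ↦ ⟨hp.1, hp.2.1.trans hp.2.2⟩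
  have h₂ : Set.MapsTo Prod.snd S (Set.Ioo α β) := fun p hp ↦ ⟨hp.1.trans hp.2.1, hp.2.2⟩
  have hleft : ContinuousOn (fun p : ℝ × ℝ ↦ f p.1 + f' p.1 * (p.2 - p.1)) S :=
    (hfco.comp continuousOn_fst h₁).add
      ((hf'co.comp continuousOn_fst h₁).mul (continuousOn_snd.sub continuousOn_fst))
  have hright : ContinuousOn (fun p : ℝ × ℝ ↦ f p.2) S := hfco.comp continuousOn_snd h₂
  have hsign : (∀ p ∈ S, f p.1 + f' p.1 * (p.2 - p.1) < f p.2) ∨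
      ∀ p ∈ S, f p.2 < f p.1 + f' p.1 * (p.2 - p.1) := by
    by_contra! hcon
    obtain ⟨⟨p, hp, hpl⟩, q, hq, hql⟩ := hcon
    obtain ⟨r, hr, hreq⟩ := (isPreconnected_ordered_pairs α β).intermediate_value₂
      hq hp hleft hright hql hpl
    exact hne r.1 r.2 hr.1 hr.2.1 hr.2.2 hreq.symm
  rcases hsign with hlt | hgt
  · exact hvar (boundedVariationOn_of_forward_tangent_lt hαβ hd hc
      fun e w he hew hw ↦ hlt (e, w) ⟨he, hew, hw⟩)
  · have hbv := boundedVariationOn_of_forward_tangent_lt (f := -f) (f' := -f') hαβ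
      (fun x hx ↦ (hd x hx).neg) hc.neg fun e w he hew hw ↦ by
        have := hgt (e, w) ⟨he, hew, hw⟩
        simp only [Pi.neg_apply]
        linarith
    apply hvar
    simpa [BoundedVariationOn, eVariationOn, edist_neg_neg] using hbv
end

section
/- Let X be a separable Banach space with dim X ≥ 2 and let f : X → ℝ be a linearly continuous function having the Baire property. Then the set D(f) of all discontinuity points of f can be written as D(f) = ⋃_{k=1}^∞ B_k where each B_k satisfies: (i) B_k is a bounded closed subset of a Lipschitz hypersurface L_k ⊂ X and B_k is nowhere dense in L_k (with the subspace topology); (ii) for every continuous linear projection π of X onto a closed hyperplane H ⊂ X containing 0, the image π(B_k) is a first category (meager) subset of H; (iii) for each c ∈ X \ B_k, the set {(x − c)/‖x − c‖ : x ∈ B_k} is a first category (meager) set in the unit sphere S_X = {x ∈ X : ‖x‖ = 1}. -/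
open Module

/-- A function on a real normed space is linearly continuous if it is continuous
on every line. -/
def LinearlyContinuous {X : Type*} [NormedAddCommGroup X] [NormedSpace ℝ X]
    (f : X → ℝ) : Prop :=
  ∀ a v : X, Continuous fun t : ℝ => f (a + t • v)

/-- A function has the Baire property if preimages of Borel sets have the
Baire property (are Baire measurable). -/
def HasBaireProperty {X : Type*} [TopologicalSpace X] (f : X → ℝ) : Prop :=
  ∀ B : Set ℝ, MeasurableSet B → BaireMeasurableSet (f ⁻¹' B)

/-- A Lipschitz hypersurface: the "graph" `{y + φ y : y ∈ Y}` of a Lipschitz map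
`φ : Y → V` where `V` is a 1-dimensional subspace and `Y` a topological complement. -/
def IsLipschitzHypersurface {X : Type*} [NormedAddCommGroup X] [NormedSpace ℝ X]
    (A : Set X) : Prop :=
  ∃ V Y : Submodule ℝ X, Module.finrank ℝ V = 1 ∧ IsCompl V Y ∧ IsClosed (Y : Set X) ∧
    ∃ (K : NNReal) (φ : Y → V), LipschitzWith K φ ∧
      A = {x : X | ∃ y : Y, x = (y : X) + (φ y : X)}

open Set Filter Topology

theorem exists_pos_notMem_interior_of_not_continuousAt {X : Type*} [TopologicalSpace X]
    {f : X → ℝ} {x : X} (h : ¬ ContinuousAt f x) :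
    ∃ η > 0, ∀ q e : ℝ, |f x - q| < η → e < η → x ∉ interior {y | |f y - q| ≤ e} := by
  by_contra! H
  refine h (Metric.continuousAt_iff'.2 fun ε hε => ?_)
  obtain ⟨q, e, hq, he, hx⟩ := H (ε / 2) (half_pos hε)
  filter_upwards [mem_interior_iff_mem_nhds.1 hx] with y hy
  have hy' : |f y - q| ≤ e := hy
  rw [Real.dist_eq]
  rw [abs_lt] at hq ⊢
  rw [abs_le] at hy'
  constructor <;> linarith [hq.1, hq.2, hy'.1, hy'.2]

/-- Quasicontinuity of a real function: near every point there are nonempty open sets on which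
the function is close to its value at the point. -/
def QuasiContinuous {X : Type*} [TopologicalSpace X] (f : X → ℝ) : Prop :=
  ∀ y, ∀ N ∈ 𝓝 y, ∀ ε > 0, ∃ W : Set X, IsOpen W ∧ W.Nonempty ∧ W ⊆ N ∧
    ∀ w ∈ W, |f w - f y| < ε

/-- If `Ψ` is an open parametrization by `Z × J` along whose fibres `f` is continuous, then only
a meagre set of fibres meets the set of discontinuity points of `f`. -/
theorem QuasiContinuous.isMeagre_fibres {X Z : Type*} [TopologicalSpace X] [TopologicalSpace Z]
    {f : X → ℝ} (hq : QuasiContinuous f) {Ψ : Z × ℝ → X} (hΨ : Continuous Ψ) {J : Set ℝ}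
    (hJ : IsOpen J) (hopen : ∀ z, ∀ t ∈ J, 𝓝 (Ψ (z, t)) ≤ map Ψ (𝓝 (z, t)))
    (hf : ∀ z, Continuous fun t => f (Ψ (z, t))) :
    IsMeagre {z | ∃ t ∈ J, ¬ ContinuousAt f (Ψ (z, t))} := by
  let T : ℚ × ℚ × ℚ × ℚ → Set Z := fun p =>
    {z | Ioo (p.1 : ℝ) p.2.1 ⊆ J ∧
      (∀ s ∈ Ioo (p.1 : ℝ) p.2.1, |f (Ψ (z, s)) - p.2.2.1| ≤ p.2.2.2) ∧
      ∃ t ∈ Ioo (p.1 : ℝ) p.2.1, Ψ (z, t) ∉ interior {x | |f x - p.2.2.1| ≤ p.2.2.2}}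
  have hT : ∀ p, IsMeagre (T p) := by
    rintro ⟨a, b, q, e⟩
    refine IsNowhereDense.isMeagre (isNowhereDense_iff_forall_notMem_nhds.2 ?_)
    rintro z ⟨hab, -, t, ht, hzt⟩ hz
    dsimp only at hab ht hzt
    refine hzt (mem_interior_iff_mem_nhds.2 ?_)
    set U := interior (closure (T (a, b, q, e)))
    have hmem : ∀ z ∈ U, ∀ t ∈ Ioo (a : ℝ) b, Ψ '' (U ×ˢ Ioo (a : ℝ) b) ∈ 𝓝 (Ψ (z, t)) := by
      intro z hz t ht
      exact hopen z t (hab ht) (mem_map.2 (mem_of_superset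
        (prod_mem_nhds (isOpen_interior.mem_nhds hz) (isOpen_Ioo.mem_nhds ht))
        (subset_preimage_image _ _)))
    refine mem_of_superset (hmem z (mem_interior_iff_mem_nhds.2 hz) t ht) ?_
    rintro _ ⟨⟨z₁, t₁⟩, ⟨hz₁, ht₁⟩, rfl⟩
    by_contra hcon
    have hcon' : (e : ℝ) < |f (Ψ (z₁, t₁)) - q| := not_le.1 hcon
    obtain ⟨W, hWo, ⟨w, hw⟩, hWN, hW⟩ :=
      hq _ _ (hmem z₁ hz₁ t₁ ht₁) _ (sub_pos.2 hcon')
    obtain ⟨⟨z₂, t₂⟩, ⟨hz₂, ht₂⟩, rfl⟩ := hWN hw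
    have hV : {z | Ψ (z, t₂) ∈ W} ∈ 𝓝 z₂ :=
      (hWo.preimage (hΨ.comp (Continuous.prodMk_left t₂))).mem_nhds hw
    obtain ⟨z₃, hz₃W, hz₃⟩ := mem_closure_iff_nhds.1 (interior_subset hz₂) _ hV
    have h1 : |f (Ψ (z₃, t₂)) - q| ≤ e := hz₃.2.1 t₂ ht₂
    have h2 := hW _ hz₃W
    have h3 := abs_sub_le (f (Ψ (z₁, t₁))) (f (Ψ (z₃, t₂))) q
    rw [abs_sub_comm] at h2
    linarith
  refine (isMeagre_iUnion hT).mono ?_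
  rintro z ⟨t, ht, hz⟩
  obtain ⟨η, hη, H⟩ := exists_pos_notMem_interior_of_not_continuousAt hz
  obtain ⟨e, he0, he⟩ := exists_rat_btwn hη
  obtain ⟨q, hq1, hq2⟩ := exists_rat_btwn (show f (Ψ (z, t)) < f (Ψ (z, t)) + e / 2 by linarith)
  have hn : {s | |f (Ψ (z, s)) - q| ≤ e} ∩ J ∈ 𝓝 t := by
    refine inter_mem ?_ (hJ.mem_nhds ht)
    have := (hf z).continuousAt (x := t)
    filter_upwards [Metric.continuousAt_iff'.1 this (e / 2) (by linarith)] with s hs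
    rw [Real.dist_eq, abs_lt] at hs
    refine (abs_le.2 ?_ : |f (Ψ (z, s)) - q| ≤ e)
    constructor <;> linarith [hs.1, hs.2]
  obtain ⟨l, r, ⟨hl, hr⟩, hlr⟩ := mem_nhds_iff_exists_Ioo_subset.1 hn
  obtain ⟨a, hla, hat⟩ := exists_rat_btwn hl
  obtain ⟨b, htb, hbr⟩ := exists_rat_btwn hr
  have hsub : Ioo (a : ℝ) b ⊆ Ioo l r := Ioo_subset_Ioo hla.le hbr.le
  refine mem_iUnion.2 ⟨(a, b, q, e), fun s hs => (hlr (hsub hs)).2,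
    fun s hs => (hlr (hsub hs)).1, t, ⟨hat, htb⟩, H _ _ ?_ he⟩
  rw [abs_sub_comm, abs_lt]
  constructor <;> linarith

section NormedSpace

variable {X : Type*} [NormedAddCommGroup X] [NormedSpace ℝ X] {f : X → ℝ}

theorem LinearlyContinuous.exists_open_cone [CompleteSpace X] (hlin : LinearlyContinuous f)
    (hBaire : HasBaireProperty f) (x : X) {ε : ℝ} (hε : 0 < ε) :
    ∃ u : Set X, IsOpen u ∧ u.Nonempty ∧ ∃ δ > 0, ∀ v ∈ u, ∀ t : ℝ, |t| < δ →
      |f (x + t • v) - f x| ≤ ε := by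
  let S : ℕ → Set X := fun n => {v | ∀ t : ℝ, |t| < 1 / ((n : ℝ) + 1) → |f (x + t • v) - f x| ≤ ε}
  have hSrat : ∀ n, S n = ⋂ t : ℚ, {v | |(t : ℝ)| < 1 / ((n : ℝ) + 1) →
      |f (x + (t : ℝ) • v) - f x| ≤ ε} := by
    intro n
    ext v
    refine ⟨fun h => mem_iInter.2 fun t => h t, fun h t ht => ?_⟩
    by_contra! hcon
    have hopen : IsOpen ({t : ℝ | ε < |f (x + t • v) - f x|} ∩ {t | |t| < 1 / ((n : ℝ) + 1)}) :=
      (isOpen_lt continuous_const ((hlin x v).sub continuous_const).abs).inter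
        (isOpen_lt continuous_abs continuous_const)
    obtain ⟨q, hq1, hq2⟩ := Rat.denseRange_cast.exists_mem_open hopen ⟨t, hcon, ht⟩
    exact absurd (mem_iInter.1 h q hq2) (not_le.2 hq1)
  have hSB : ∀ n, BaireMeasurableSet (S n) := by
    intro n
    rw [hSrat]
    refine BaireMeasurableSet.iInter fun t => ?_
    by_cases ht : |(t : ℝ)| < 1 / ((n : ℝ) + 1)
    · rcases eq_or_ne (t : ℝ) 0 with h0 | h0
      · convert (isOpen_univ (X := X)).baireMeasurableSet
        simp [h0, hε.le]
      · have hpre := hBaire {r | |r - f x| ≤ ε}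
          (isClosed_le (by fun_prop) continuous_const).measurableSet
        have := hpre.preimage (f := fun v => x + (t : ℝ) • v) (by fun_prop)
          ((Homeomorph.smulOfNeZero (α := X) (t : ℝ) h0).trans (Homeomorph.addLeft x)).isOpenMap
        convert this using 1
        ext v
        exact ⟨fun h => h ht, fun h _ => h⟩
    · convert (isOpen_univ (X := X)).baireMeasurableSet
      exact eq_univ_of_forall fun v h => absurd h ht
  have hcover : ⋃ n, S n = univ := by
    refine eq_univ_of_forall fun v => ?_
    have hc := (hlin x v).continuousAt (x := 0)
    obtain ⟨δ, hδ, h⟩ := Metric.continuousAt_iff.1 hc ε hε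
    obtain ⟨n, hn⟩ := exists_nat_one_div_lt hδ
    refine mem_iUnion.2 ⟨n, fun t ht => ?_⟩
    have := h (x := t) (by rw [Real.dist_eq, sub_zero]; exact ht.trans hn)
    simpa [Real.dist_eq] using this.le
  obtain ⟨n, hn⟩ : ∃ n, ¬ IsMeagre (S n) := by
    by_contra! h
    have := isMeagre_iUnion h
    rw [hcover] at this
    exact not_isMeagre_of_isOpen isOpen_univ univ_nonempty this
  obtain ⟨u, hu, hSu⟩ := (hSB n).residualEq_isOpen
  refine ⟨u, hu, ?_, 1 / ((n : ℝ) + 1), Nat.one_div_pos_of_nat, fun v hv t ht => ?_⟩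
  · by_contra hne
    rw [not_nonempty_iff_eq_empty.1 hne] at hSu
    refine hn ?_
    filter_upwards [hSu.mem_iff] with v hv using fun h => hv.1 h
  · have hres : ∀ᶠ d in residual X, ∀ k : ℕ, v + (1 / ((k : ℝ) + 1)) • d ∈ u →
        v + (1 / ((k : ℝ) + 1)) • d ∈ S n := by
      rw [eventually_countable_forall]
      intro k
      have h0 : 1 / ((k : ℝ) + 1) ≠ 0 := Nat.one_div_pos_of_nat.ne'
      exact (tendsto_residual_of_isOpenMap (f := fun d : X => v + (1 / ((k : ℝ) + 1)) • d)
        (by fun_prop) ((Homeomorph.smulOfNeZero (α := X) _ h0).trans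
          (Homeomorph.addLeft v)).isOpenMap).eventually (hSu.mem_iff.mono fun _ h => h.2)
    obtain ⟨d, hd⟩ := (dense_of_mem_residual hres).nonempty
    have hlim : Tendsto (fun k : ℕ => 1 / ((k : ℝ) + 1)) atTop (𝓝 0) :=
      tendsto_one_div_add_atTop_nhds_zero_nat
    have hv' : Tendsto (fun k : ℕ => v + (1 / ((k : ℝ) + 1)) • d) atTop (𝓝 v) := by
      simpa using (hlim.smul_const d).const_add v
    have hfl : Tendsto (fun k : ℕ => |f ((x + t • v) + (1 / ((k : ℝ) + 1)) • (t • d)) - f x|)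
        atTop (𝓝 |f (x + t • v) - f x|) := by
      have := ((hlin (x + t • v) (t • d)).tendsto 0).comp hlim
      simp only [zero_smul, add_zero] at this
      exact (this.sub_const _).abs
    refine le_of_tendsto hfl ?_
    filter_upwards [hv'.eventually (hu.mem_nhds hv)] with k hk
    have := hd k hk t ht
    rwa [show x + t • (v + (1 / ((k : ℝ) + 1)) • d) =
      (x + t • v) + (1 / ((k : ℝ) + 1)) • (t • d) by
        rw [smul_add, smul_comm, add_assoc]] at this

theorem isOpen_cone_section {x : X} {t : ℝ} (ht : t ≠ 0) {u : Set X} (hu : IsOpen u) :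
    IsOpen ((fun v => x + t • v) '' u) :=
  ((Homeomorph.smulOfNeZero (α := X) t ht).trans (Homeomorph.addLeft x)).isOpenMap u hu

theorem LinearlyContinuous.quasiContinuous [CompleteSpace X] (hlin : LinearlyContinuous f)
    (hBaire : HasBaireProperty f) : QuasiContinuous f := by
  intro y N hN ε hε
  obtain ⟨u, hu, ⟨v, hv⟩, δ, hδ, h⟩ := hlin.exists_open_cone hBaire y (half_pos hε)
  have hc : Continuous fun t : ℝ => y + t • v := by fun_prop
  have h1 : ∀ᶠ t : ℝ in 𝓝[≠] 0, y + t • v ∈ interior N := by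
    refine (hc.continuousAt.eventually_mem ?_).filter_mono nhdsWithin_le_nhds
    simpa using hN
  have h2 : ∀ᶠ t : ℝ in 𝓝[≠] 0, |t| < δ :=
    (continuous_abs.continuousAt.eventually_lt continuousAt_const (by simpa using hδ)).filter_mono
      nhdsWithin_le_nhds
  obtain ⟨t, ⟨ht1, ht2⟩, ht0⟩ := ((h1.and h2).and self_mem_nhdsWithin).exists
  refine ⟨interior N ∩ (fun v => y + t • v) '' u, isOpen_interior.inter
    (isOpen_cone_section ht0 hu), ⟨_, ht1, v, hv, rfl⟩, fun w hw => interior_subset hw.1, ?_⟩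
  rintro _ ⟨-, v', hv', rfl⟩
  exact (h v' hv' t ht2).trans_lt (half_lt_self hε)

theorem QuasiContinuous.isMeagre_hyperplane [CompleteSpace X] (hq : QuasiContinuous f)
    (hlin : LinearlyContinuous f) {H : Submodule ℝ X} (hH : IsClosed (H : Set X)) (w : X)
    (hw : ∀ x, ∃ h : H, ∃ t : ℝ, x = h + t • w) :
    IsMeagre {h : H | ∃ t : ℝ, ¬ ContinuousAt f (h + t • w)} := by
  have := hH.completeSpace_coe
  let Ψ : H × ℝ →L[ℝ] X := H.subtypeL.coprod (ContinuousLinearMap.toSpanSingleton ℝ w)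
  have hΨ : ∀ h : H, ∀ t : ℝ, Ψ (h, t) = h + t • w := fun h t => by simp [Ψ]
  have hsurj : Function.Surjective Ψ := fun x => by
    obtain ⟨h, t, rfl⟩ := hw x
    exact ⟨(h, t), hΨ h t⟩
  have := hq.isMeagre_fibres Ψ.continuous isOpen_univ
    (fun z t _ => (Ψ.isOpenMap hsurj).nhds_le _) (fun z => by simp only [hΨ]; exact hlin z w)
  simpa [hΨ] using this

theorem QuasiContinuous.isMeagre_sphere (hq : QuasiContinuous f)
    (hlin : LinearlyContinuous f) (c : X) :
    IsMeagre {z : Metric.sphere (0 : X) 1 | ∃ t ∈ Ioi (0 : ℝ),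
      ¬ ContinuousAt f (c + t • (z : X))} := by
  refine hq.isMeagre_fibres (Ψ := fun p : Metric.sphere (0 : X) 1 × ℝ => c + p.2 • (p.1 : X))
    (by fun_prop) isOpen_Ioi (fun z t ht => ?_) (fun z => hlin c z)
  classical
  have ht0 : (0 : ℝ) < t := ht
  have hz : ‖(z : X)‖ = 1 := by simp
  let r : X → Metric.sphere (0 : X) 1 := fun x =>
    if hx : x - c = 0 then z else ⟨‖x - c‖⁻¹ • (x - c), by
      simp [norm_smul, norm_ne_zero_iff.2 hx]⟩
  have hr : ∀ x, x - c ≠ 0 → (r x : X) = ‖x - c‖⁻¹ • (x - c) := fun x hx => by simp [r, hx]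
  have hne : c + t • (z : X) - c ≠ 0 := by
    rw [add_sub_cancel_left, ← norm_ne_zero_iff, norm_smul, hz, Real.norm_eq_abs]
    simp [ht0.ne']
  have hev : ∀ᶠ x in 𝓝 (c + t • (z : X)), x - c ≠ 0 :=
    (continuous_id.sub continuous_const).continuousAt.eventually_ne hne
  refine le_map_of_right_inverse (mba := fun x => (r x, ‖x - c‖)) ?_ ?_
  · filter_upwards [hev] with x hx
    simp [hr x hx, smul_smul, norm_ne_zero_iff.2 hx]
  · refine Tendsto.prodMk_nhds (tendsto_subtype_rng.2 ?_) ?_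
    · have : Tendsto (fun x => ‖x - c‖⁻¹ • (x - c)) (𝓝 (c + t • (z : X))) (𝓝 (z : X)) := by
        have h1 : ContinuousAt (fun x => ‖x - c‖⁻¹ • (x - c)) (c + t • (z : X)) :=
          ContinuousAt.smul (ContinuousAt.inv₀ (by fun_prop) (norm_ne_zero_iff.2 hne))
            (by fun_prop)
        convert h1.tendsto using 2
        rw [add_sub_cancel_left, norm_smul, hz, Real.norm_eq_abs, abs_of_pos ht0, mul_one,
          smul_smul, inv_mul_cancel₀ ht0.ne', one_smul]
      exact this.congr' (hev.mono fun x hx => (hr x hx).symm)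
    · have : Continuous fun x : X => ‖x - c‖ := by fun_prop
      convert this.tendsto _ using 2
      rw [add_sub_cancel_left, norm_smul, hz, Real.norm_eq_abs, abs_of_pos ht0, mul_one]

/-- The projection along `u` onto the kernel of a functional `l` with `l u = 1`. -/
def kerProj (l : StrongDual ℝ X) {u : X} (hu : l u = 1) (x : X) : l.ker :=
  ⟨x - l x • u, by simp [hu]⟩

theorem exists_isLipschitzHypersurface_superset {l : StrongDual ℝ X} {u : X} (hu : l u = 1)
    {B : Set X} {K : NNReal}
    (hB : ∀ x ∈ B, ∀ y ∈ B, |l x - l y| ≤ K * ‖(x - l x • u) - (y - l y • u)‖) :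
    ∃ g : l.ker → ℝ, Continuous g ∧
      IsLipschitzHypersurface {x : X | ∃ y : l.ker, x = y + g y • u} ∧
      B ⊆ {x : X | ∃ y : l.ker, x = y + g y • u} := by
  have hu0 : u ≠ 0 := by rintro rfl; simp at hu
  have hlip : LipschitzOnWith K (l ∘ Function.invFunOn (kerProj l hu) B)
      (kerProj l hu '' B) := by
    refine LipschitzOnWith.of_dist_le_mul fun y hy z hz => ?_
    have h1 := hB _ (Function.invFunOn_mem hy) _ (Function.invFunOn_mem hz)
    have h2 := congrArg Subtype.val (Function.invFunOn_eq hy)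
    have h3 := congrArg Subtype.val (Function.invFunOn_eq hz)
    rw [Real.dist_eq, Subtype.dist_eq, dist_eq_norm, ← h2, ← h3]
    exact h1
  obtain ⟨g, hg, hgl⟩ := hlip.extend_real
  refine ⟨g, hg.continuous, ⟨Submodule.span ℝ {u}, l.ker, finrank_span_singleton hu0,
    ?_, l.isClosed_ker, K * ‖u‖₊,
    fun y => ⟨g y • u, Submodule.smul_mem _ _ (Submodule.mem_span_singleton_self u)⟩,
    LipschitzWith.of_dist_le_mul fun y z => ?_, rfl⟩, fun x hx => ⟨kerProj l hu x, ?_⟩⟩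
  · rw [isCompl_iff, Submodule.disjoint_def, codisjoint_iff, Submodule.eq_top_iff']
    refine ⟨fun x hx hxl => ?_, fun x => Submodule.mem_sup.2
      ⟨l x • u, Submodule.smul_mem _ _ (Submodule.mem_span_singleton_self u),
        kerProj l hu x, (kerProj l hu x).2, by simp [kerProj]⟩⟩
    obtain ⟨t, rfl⟩ := Submodule.mem_span_singleton.1 hx
    have : t = 0 := by simpa [hu] using hxl
    simp [this]
  · have h := hg.dist_le_mul y z
    rw [Real.dist_eq] at h
    rw [Subtype.dist_eq, dist_eq_norm, ← sub_smul, norm_smul, Real.norm_eq_abs]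
    calc |g y - g z| * ‖u‖ ≤ (K * dist y z) * ‖u‖ := by gcongr
      _ = ((K * ‖u‖₊ : NNReal) : ℝ) * dist y z := by push_cast; ring
  · have himg : kerProj l hu x ∈ kerProj l hu '' B := mem_image_of_mem _ hx
    have hinv := Function.invFunOn_mem himg
    have heq := congrArg Subtype.val (Function.invFunOn_eq himg)
    have h1 := hB _ hinv _ hx
    have heq' : Function.invFunOn (kerProj l hu) B (kerProj l hu x) -
      l (Function.invFunOn (kerProj l hu) B (kerProj l hu x)) • u = x - l x • u := heq
    rw [heq', sub_self, norm_zero, mul_zero, abs_nonpos_iff, sub_eq_zero] at h1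
    rw [← hgl himg, Function.comp_apply, h1]
    simp [kerProj]

theorem isNowhereDense_graph [CompleteSpace X] (hq : QuasiContinuous f)
    (hlin : LinearlyContinuous f) {l : StrongDual ℝ X} {u : X} (hu : l u = 1)
    {B L : Set X} (hB : IsClosed B) (hBf : ∀ x ∈ B, ¬ ContinuousAt f x)
    {g : l.ker → ℝ} (hg : Continuous g)
    (hL : L = {x : X | ∃ y : l.ker, x = y + g y • u}) :
    IsNowhereDense ((Subtype.val ⁻¹' B) : Set L) := by
  have hker : IsClosed (l.ker : Set X) := l.isClosed_ker
  have := hker.completeSpace_coe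
  rw [(hB.preimage continuous_subtype_val).isNowhereDense_iff]
  by_contra hne
  obtain ⟨⟨x, hxL⟩, hx⟩ := nonempty_iff_ne_empty.2 hne
  let G : l.ker → L := fun y => ⟨y + g y • u, hL ▸ ⟨y, rfl⟩⟩
  have hG : Continuous G := Continuous.subtype_mk (by fun_prop) _
  obtain ⟨y, hy⟩ : ∃ y : l.ker, x = y + g y • u := by rw [hL] at hxL; exact hxL
  have hGy : G y = ⟨x, hxL⟩ := Subtype.ext hy.symm
  refine not_isMeagre_of_isOpen (isOpen_interior.preimage hG) ⟨y, by rwa [mem_preimage, hGy]⟩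
    ((hq.isMeagre_hyperplane hlin hker u
      fun x => ⟨kerProj l hu x, l x, by simp [kerProj]⟩).mono ?_)
  intro z hz
  have hzB : G z ∈ (Subtype.val ⁻¹' B : Set L) := interior_subset hz
  exact ⟨g z, hBf _ hzB⟩

theorem isMeagre_image_projection [CompleteSpace X] (hq : QuasiContinuous f)
    (hlin : LinearlyContinuous f) {B : Set X} (hBf : ∀ x ∈ B, ¬ ContinuousAt f x)
    {H : Submodule ℝ X} (hH : IsClosed (H : Set X)) (hrank : finrank ℝ (X ⧸ H) = 1)
    (π : X →L[ℝ] X) (hrange : range π = (H : Set X)) (hπ : ∀ x ∈ H, π x = x) :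
    IsMeagre ((Subtype.val ⁻¹' (π '' B)) : Set H) := by
  have hmem : ∀ x, π x ∈ H := fun x => by
    rw [← SetLike.mem_coe, ← hrange]; exact mem_range_self x
  obtain ⟨q, -, hqs⟩ := finrank_eq_one_iff'.1 hrank
  obtain ⟨w, rfl⟩ := H.mkQ_surjective q
  have hdec : ∀ x, ∃ t : ℝ, x = π x + t • (w - π w) := by
    intro x
    obtain ⟨t, ht⟩ := hqs (H.mkQ x)
    rw [← map_smul, ← sub_eq_zero, ← map_sub, Submodule.mkQ_apply,
      Submodule.Quotient.mk_eq_zero] at ht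
    have := hπ _ ht
    rw [map_sub, map_smul] at this
    refine ⟨t, ?_⟩
    rw [smul_sub, add_sub, eq_sub_iff_add_eq, ← sub_eq_zero]
    rw [← sub_eq_zero] at this
    rw [← this]
    abel
  refine (hq.isMeagre_hyperplane hlin hH (w - π w) fun x => ?_).mono ?_
  · obtain ⟨t, ht⟩ := hdec x
    exact ⟨⟨π x, hmem x⟩, t, ht⟩
  · rintro h ⟨x, hx, hxh⟩
    obtain ⟨t, ht⟩ := hdec x
    refine ⟨t, ?_⟩
    rw [← hxh, ← ht]
    exact hBf x hx

theorem isMeagre_image_radial (hq : QuasiContinuous f)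
    (hlin : LinearlyContinuous f) {B : Set X} (hBf : ∀ x ∈ B, ¬ ContinuousAt f x) (c : X) :
    IsMeagre ((Subtype.val ⁻¹' ((fun x => ‖x - c‖⁻¹ • (x - c)) '' B)) :
      Set (Metric.sphere (0 : X) 1)) := by
  refine (hq.isMeagre_sphere hlin c).mono ?_
  rintro z ⟨x, hx, hxz⟩
  have hxz' : ‖x - c‖⁻¹ • (x - c) = z := hxz
  have hne : ‖x - c‖ ≠ 0 := by
    intro h0
    have : ‖(z : X)‖ = 1 := by simp
    rw [← hxz', h0] at this
    simp at this
  refine ⟨‖x - c‖, lt_of_le_of_ne (norm_nonneg _) hne.symm, ?_⟩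
  rw [← hxz', smul_smul, mul_inv_cancel₀ hne, one_smul, add_sub_cancel]
  exact hBf x hx

/-- The points of a small closed ball at which `f` deviates from `q` by more than `2 * ε`
arbitrarily nearby, although it stays within `ε` of `q` on a cone of size `δ` around the
direction `u`. -/
def coneDiscontinuities (f : X → ℝ) (u c : X) (q ε δ : ℝ) : Set X :=
  {x | dist x c ≤ δ * ‖u‖ / 3 ∧ x ∉ interior {y | |f y - q| ≤ 2 * ε} ∧
    ∀ t : ℝ, |t| < δ → t ≠ 0 → ∀ v ∈ Metric.ball u δ, |f (x + t • v) - q| ≤ ε}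

variable {u c : X} {q ε δ : ℝ}

theorem isBounded_coneDiscontinuities :
    Bornology.IsBounded (coneDiscontinuities f u c q ε δ) :=
  Metric.isBounded_closedBall.subset fun _ hx => Metric.mem_closedBall.2 hx.1

theorem isClosed_coneDiscontinuities : IsClosed (coneDiscontinuities f u c q ε δ) := by
  refine IsClosed.and (isClosed_le (by fun_prop) continuous_const)
    (IsClosed.and isOpen_interior.isClosed_compl
      (isClosed_of_closure_subset fun x hx => ?_))
  intro t ht ht0 v hv
  have hcont : Continuous fun y : X => v + t⁻¹ • (x - y) := by fun_prop
  have hev : ∀ᶠ y in 𝓝 x, v + t⁻¹ • (x - y) ∈ Metric.ball u δ :=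
    hcont.continuousAt.eventually_mem (Metric.isOpen_ball.mem_nhds (by simpa using hv))
  obtain ⟨y, hy, hyc⟩ := mem_closure_iff_nhds.1 hx _ hev
  have := hyc t ht ht0 _ hy
  rwa [smul_add, smul_smul, mul_inv_cancel₀ ht0, one_smul,
    show y + (t • v + (x - y)) = x + t • v by abel] at this

theorem not_continuousAt_of_mem_coneDiscontinuities (hlin : LinearlyContinuous f) (hε : 0 < ε)
    (hδ : 0 < δ) {x : X} (hx : x ∈ coneDiscontinuities f u c q ε δ) : ¬ ContinuousAt f x := by
  intro hcont
  have hle : |f x - q| ≤ ε := by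
    have hlim : Tendsto (fun t : ℝ => |f (x + t • u) - q|) (𝓝[≠] 0) (𝓝 |f x - q|) := by
      have := ((hlin x u).tendsto 0).mono_left (nhdsWithin_le_nhds (s := {0}ᶜ))
      simp only [zero_smul, add_zero] at this
      exact (this.sub_const _).abs
    refine le_of_tendsto hlim ?_
    have h2 : ∀ᶠ t : ℝ in 𝓝[≠] 0, |t| < δ :=
      (continuous_abs.continuousAt.eventually_lt continuousAt_const
        (by simpa using hδ)).filter_mono nhdsWithin_le_nhds
    filter_upwards [h2, self_mem_nhdsWithin] with t ht ht0
    exact hx.2.2 t ht ht0 u (Metric.mem_ball_self hδ)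
  refine hx.2.1 (mem_interior_iff_mem_nhds.2 ?_)
  have hlt : |f x - q| < 2 * ε := by linarith
  exact ((hcont.sub continuousAt_const).abs.eventually_lt continuousAt_const hlt).mono
    fun y hy => le_of_lt hy

theorem abs_sub_le_of_mem_coneDiscontinuities (hε : 0 < ε) (hδ : 0 < δ) (hu0 : u ≠ 0)
    {l : StrongDual ℝ X} (hl : ‖l‖ ≤ ‖u‖⁻¹) {x y : X}
    (hx : x ∈ coneDiscontinuities f u c q ε δ) (hy : y ∈ coneDiscontinuities f u c q ε δ) :
    |l x - l y| ≤ δ⁻¹ * ‖(x - l x • u) - (y - l y • u)‖ := by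
  by_contra! hlt
  set s := l x - l y with hs
  have hun : 0 < ‖u‖ := norm_pos_iff.2 hu0
  have hs0 : s ≠ 0 := by
    rintro h0
    rw [h0, abs_zero] at hlt
    exact absurd hlt (not_lt.2 (by positivity))
  have hsδ : |s| < δ := by
    have h1 : |s| ≤ ‖u‖⁻¹ * ‖x - y‖ := by
      rw [hs, ← map_sub, ← Real.norm_eq_abs]
      exact (l.le_opNorm _).trans (by gcongr)
    have h2 : ‖x - y‖ ≤ δ * ‖u‖ / 3 + δ * ‖u‖ / 3 := by
      rw [← dist_eq_norm]
      exact (dist_triangle_right x y c).trans (add_le_add hx.1 hy.1)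
    calc |s| ≤ ‖u‖⁻¹ * (δ * ‖u‖ / 3 + δ * ‖u‖ / 3) := h1.trans (by gcongr)
      _ = δ * (2 / 3) := by field_simp; norm_num
      _ < δ := by linarith
  have hball : s⁻¹ • (x - y) ∈ Metric.ball u δ := by
    have hsu : s⁻¹ • (x - y) - u = s⁻¹ • ((x - l x • u) - (y - l y • u)) := by
      rw [show (x - l x • u) - (y - l y • u) = (x - y) - s • u by rw [hs, sub_smul]; abel,
        smul_sub s⁻¹ (x - y), smul_smul, inv_mul_cancel₀ hs0, one_smul]
    rw [Metric.mem_ball, dist_eq_norm, hsu, norm_smul, norm_inv, Real.norm_eq_abs,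
      inv_mul_lt_iff₀ (abs_pos.2 hs0), mul_comm]
    rwa [inv_mul_lt_iff₀ hδ] at hlt
  have hyx : y + s • (s⁻¹ • (x - y)) = x := by
    rw [smul_smul, mul_inv_cancel₀ hs0, one_smul, add_sub_cancel]
  refine hx.2.1 (mem_interior.2 ⟨(fun v => y + s • v) '' Metric.ball u δ, ?_,
    isOpen_cone_section hs0 Metric.isOpen_ball, _, hball, hyx⟩)
  rintro _ ⟨v, hv, rfl⟩
  exact (hy.2.2 s hsδ hs0 v hv).trans (by linarith)

theorem exists_mem_coneDiscontinuities [CompleteSpace X] [Nontrivial X]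
    (hlin : LinearlyContinuous f) (hBaire : HasBaireProperty f) {e : ℕ → X} (he : DenseRange e)
    {x : X} (hx : ¬ ContinuousAt f x) :
    ∃ i, e i ≠ 0 ∧ ∃ j, ∃ q : ℚ, ∃ n m : ℕ,
      x ∈ coneDiscontinuities f (e i) (e j) q (1 / ((n : ℝ) + 1)) (1 / ((m : ℝ) + 1)) := by
  obtain ⟨η, hη, H⟩ := exists_pos_notMem_interior_of_not_continuousAt hx
  obtain ⟨n, hn⟩ := exists_nat_one_div_lt (half_pos hη)
  have hε : 0 < 1 / ((n : ℝ) + 1) := Nat.one_div_pos_of_nat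
  set ε := 1 / ((n : ℝ) + 1)
  obtain ⟨q, hq1, hq2⟩ := exists_rat_btwn (show f x < f x + ε / 2 by linarith)
  have hq : |f x - q| ≤ ε / 2 := by
    rw [abs_le]
    constructor <;> linarith
  obtain ⟨u, hu, hune, δ, hδ, hcone⟩ := hlin.exists_open_cone hBaire x (half_pos hε)
  obtain ⟨i, hiu, hi0⟩ := he.exists_mem_open (hu.inter isOpen_compl_singleton)
    ((dense_compl_singleton (0 : X)).inter_open_nonempty u hu hune)
  obtain ⟨r, hr, hru⟩ := Metric.isOpen_iff.1 hu _ hiu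
  obtain ⟨m, hm⟩ := exists_nat_one_div_lt (lt_min hδ hr)
  have hm0 : 0 < 1 / ((m : ℝ) + 1) := Nat.one_div_pos_of_nat
  have hi0' : e i ≠ 0 := hi0
  have hin : 0 < ‖e i‖ := norm_pos_iff.2 hi0'
  obtain ⟨j, hj⟩ := he.exists_dist_lt x
    (show 0 < 1 / ((m : ℝ) + 1) * ‖e i‖ / 3 by positivity)
  refine ⟨i, hi0', j, q, n, m, hj.le, H _ _ (by linarith) (by linarith), fun t ht _ v hv => ?_⟩
  have h1 := hcone v (hru (Metric.ball_subset_ball (hm.le.trans (min_le_right _ _)) hv)) t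
    (ht.trans (hm.trans_le (min_le_left _ _)))
  have h2 := abs_sub_le (f (x + t • v)) (f x) q
  linarith

end NormedSpace

theorem stmt_8 {X : Type*} [NormedAddCommGroup X] [NormedSpace ℝ X] [CompleteSpace X]
    [TopologicalSpace.SeparableSpace X] (hdim : 2 ≤ Module.rank ℝ X)
    (f : X → ℝ) (hlin : LinearlyContinuous f) (hBaire : HasBaireProperty f) :
    ∃ B : ℕ → Set X,
      {x : X | ¬ ContinuousAt f x} = ⋃ k, B k ∧
      ∀ k,
        -- (i) `B k` is a bounded closed subset of a Lipschitz hypersurface `L`,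
        -- nowhere dense in `L`
        (Bornology.IsBounded (B k) ∧ IsClosed (B k) ∧
          ∃ L : Set X, IsLipschitzHypersurface L ∧ B k ⊆ L ∧
            IsNowhereDense ((Subtype.val ⁻¹' B k) : Set L)) ∧
        -- (ii) continuous linear projections onto closed hyperplanes map `B k` to
        -- meager sets
        (∀ (H : Submodule ℝ X), IsClosed (H : Set X) → finrank ℝ (X ⧸ H) = 1 →
          ∀ π : X →L[ℝ] X, Set.range π = (H : Set X) → (∀ x ∈ H, π x = x) →
            IsMeagre ((Subtype.val ⁻¹' (π '' B k)) : Set H)) ∧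
        -- (iii) radial projections from points outside `B k` are meager in `S_X`
        (∀ c ∉ B k,
          IsMeagre ((Subtype.val ⁻¹' ((fun x => ‖x - c‖⁻¹ • (x - c)) '' B k)) :
            Set (Metric.sphere (0 : X) 1))) := by
  have : Nontrivial X := by
    rw [← rank_pos_iff_nontrivial (R := ℝ)]
    exact lt_of_lt_of_le (by norm_num) hdim
  have hq : QuasiContinuous f := hlin.quasiContinuous hBaire
  let e := TopologicalSpace.denseSeq X
  have he : DenseRange e := TopologicalSpace.denseRange_denseSeq X
  obtain ⟨i₀, hi₀⟩ := he.exists_mem_open (isOpen_compl_singleton (x := (0 : X))) (exists_ne 0)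
  let I := {i // e i ≠ 0} × ℕ × ℚ × ℕ × ℕ
  have : Nonempty I := ⟨⟨i₀, hi₀⟩, 0, 0, 0, 0⟩
  obtain ⟨p, hp⟩ := exists_surjective_nat I
  let B : I → Set X := fun a => coneDiscontinuities f (e a.1) (e a.2.1) a.2.2.1
    (1 / ((a.2.2.2.1 : ℝ) + 1)) (1 / ((a.2.2.2.2 : ℝ) + 1))
  have hBf : ∀ a, ∀ x ∈ B a, ¬ ContinuousAt f x := fun a x hx =>
    not_continuousAt_of_mem_coneDiscontinuities hlin Nat.one_div_pos_of_nat
      Nat.one_div_pos_of_nat hx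
  refine ⟨fun k => B (p k), ?_, fun k => ⟨⟨isBounded_coneDiscontinuities,
    isClosed_coneDiscontinuities, ?_⟩, fun H hH hrank π hrange hπ =>
    isMeagre_image_projection hq hlin (hBf _) hH hrank π hrange hπ,
    fun c _ => isMeagre_image_radial hq hlin (hBf _) c⟩⟩
  · rw [hp.iUnion_comp B]
    refine Subset.antisymm (fun x hx => ?_) (iUnion_subset hBf)
    obtain ⟨i, hi, j, q, n, m, h⟩ := exists_mem_coneDiscontinuities hlin hBaire he hx
    exact mem_iUnion.2 ⟨(⟨i, hi⟩, j, q, n, m), h⟩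
  · have hu0 : e (p k).1 ≠ 0 := (p k).1.2
    have hun : ‖e (p k).1‖ ≠ 0 := norm_ne_zero_iff.2 hu0
    obtain ⟨g, hg1, hgu⟩ := exists_dual_vector ℝ _ hun
    let l : StrongDual ℝ X := ‖e (p k).1‖⁻¹ • g
    have hlu : l (e (p k).1) = 1 := by simp [l, hgu, hun]
    have hl : ‖l‖ ≤ ‖e (p k).1‖⁻¹ := by simp [l, norm_smul, hg1]
    obtain ⟨φ, hφ, hL, hBL⟩ := exists_isLipschitzHypersurface_superset
      (K := ⟨(1 / (((p k).2.2.2.2 : ℝ) + 1))⁻¹, by positivity⟩) (B := B (p k)) hlu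
      fun x hx y hy => abs_sub_le_of_mem_coneDiscontinuities Nat.one_div_pos_of_nat
        Nat.one_div_pos_of_nat hu0 hl hx hy
    exact ⟨_, hL, hBL, isNowhereDense_graph hq hlin hlu isClosed_coneDiscontinuities (hBf _)
      hφ rfl⟩
end

section
/- Let X be a separable Banach space with dim X ≥ 2, let v ∈ X with ‖v‖ = 1, let Y be a topological complement of V := span{v}, and let π_Y : X → Y denote the projection of X onto Y in the direction of V (i.e. along V). If A ⊂ X is an l-miserable set, then π_Y(A) is a first category (meager) subset of Y. -/
/-- `L` is an l-neighborhood of `A`: every point of `A` can be moved inside `L`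
for a short time in any direction. -/
def IsLNeighborhood {X : Type*} [NormedAddCommGroup X] [NormedSpace ℝ X]
    (L A : Set X) : Prop :=
  ∀ a ∈ A, ∀ v : X, ∃ ε > (0:ℝ), ∀ t ∈ Set.Ico (0:ℝ) ε, a + t • v ∈ L

/-- `A` is l-miserable if `A ⊆ closure (X \ L)` for some closed l-neighborhood `L` of `A`. -/
def IsLMiserable {X : Type*} [NormedAddCommGroup X] [NormedSpace ℝ X]
    (A : Set X) : Prop :=
  ∃ L : Set X, IsClosed L ∧ IsLNeighborhood L A ∧ A ⊆ closure Lᶜ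

open Topology in
/-- Let `K` be closed in `Y × ℝ` and let `B` miss the interior of `K`. If every point of `B` is
interior to the fibre of `K` through it, then `B` projects to a meagre subset of `Y`. -/
theorem isMeagre_image_fst_of_fibre_mem_nhds {Y : Type*} [TopologicalSpace Y]
    {K B : Set (Y × ℝ)} (hK : IsClosed K) (hfib : ∀ b ∈ B, ∀ᶠ s in 𝓝 b.2, (b.1, s) ∈ K)
    (hint : ∀ b ∈ B, K ∉ 𝓝 b) : IsMeagre (Prod.fst '' B) := by
  let F : ℚ × ℚ → Set Y := fun q ↦ {y | ∀ s ∈ Set.Icc (q.1 : ℝ) q.2, (y, s) ∈ K}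
  have hF : ∀ q, IsClosed (F q) := fun q ↦ by
    simp only [F, Set.ofPred_forall]
    exact isClosed_iInter fun s ↦ isClosed_iInter fun _ ↦
      hK.preimage (Continuous.prodMk_left s)
  have hmeagre : IsMeagre (⋃ q, frontier (F q)) :=
    isMeagre_iUnion fun q ↦ IsNowhereDense.isMeagre <| by
      rw [isClosed_frontier.isNowhereDense_iff]
      exact interior_frontier (hF q)
  refine hmeagre.mono ?_
  rintro _ ⟨⟨y, s⟩, hb, rfl⟩
  obtain ⟨l, u, ⟨hls, hsu⟩, hlu⟩ := mem_nhds_iff_exists_Ioo_subset.mp (hfib _ hb)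
  obtain ⟨p, hlp, hps⟩ := exists_rat_btwn hls
  obtain ⟨q, hsq, hqu⟩ := exists_rat_btwn hsu
  refine Set.mem_iUnion.mpr ⟨(p, q), ?_⟩
  rw [(hF _).frontier_eq]
  refine ⟨fun t ht ↦ hlu ⟨hlp.trans_le ht.1, ht.2.trans_lt hqu⟩, fun hy ↦ hint _ hb ?_⟩
  filter_upwards [prod_mem_nhds (mem_interior_iff_mem_nhds.mp hy) (Icc_mem_nhds hps hsq)]
    with x hx using hx.1 _ hx.2

theorem IsLNeighborhood.eventually_add_smul_mem {X : Type*} [NormedAddCommGroup X]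
    [NormedSpace ℝ X] {L A : Set X} (h : IsLNeighborhood L A) {a : X} (ha : a ∈ A) (v : X) :
    ∀ᶠ t in nhds (0 : ℝ), a + t • v ∈ L := by
  obtain ⟨ε, hε, hpos⟩ := h a ha v
  obtain ⟨δ, hδ, hneg⟩ := h a ha (-v)
  filter_upwards [Ioo_mem_nhds (neg_lt_zero.mpr hδ) hε] with t ht
  rcases le_total 0 t with h0 | h0
  · exact hpos t ⟨h0, ht.2⟩
  · simpa using hneg (-t) ⟨neg_nonneg.mpr h0, neg_lt.mp ht.1⟩

theorem stmt_9 {X : Type*} [NormedAddCommGroup X] [NormedSpace ℝ X] [CompleteSpace X]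
    [TopologicalSpace.SeparableSpace X] (hdim : 2 ≤ Module.rank ℝ X)
    (v : X) (hv : ‖v‖ = 1) (Y : Submodule ℝ X) (hYclosed : IsClosed (Y : Set X))
    (hcompl : IsCompl (Submodule.span ℝ {v}) Y)
    (π : X → X) (hπY : ∀ x, π x ∈ Y) (hπV : ∀ x, x - π x ∈ Submodule.span ℝ {v})
    (A : Set X) (hA : IsLMiserable A) :
    IsMeagre ((Subtype.val ⁻¹' (π '' A)) : Set Y) := by
  obtain ⟨L, hL, hLA, hAL⟩ := hA
  have htop : Submodule.IsTopCompl Y (Submodule.span ℝ {v}) :=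
    Submodule.IsCompl.isTopCompl_of_isClosed hcompl.symm hYclosed (Submodule.closed_of_finiteDimensional _)
  let P := Y.projectionOntoL _ htop
  have hP : ∀ x, (P x : X) = π x := fun x ↦ by
    have h : P (x - π x) = 0 := Submodule.projectionOntoL_apply_eq_zero_of_mem_right htop (hπV x)
    have h' : P (π x) = ⟨π x, hπY x⟩ := Submodule.projectionOntoL_apply_left htop ⟨π x, hπY x⟩
    rw [map_sub, sub_eq_zero, h'] at h
    rw [h]
  obtain ⟨g, -, hg⟩ := exists_dual_vector ℝ v (by simp [hv])
  let φ : Y × ℝ → X := fun z ↦ z.1 + z.2 • v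
  let ψ : X → Y × ℝ := fun x ↦ (P x, g (x - P x))
  have hφ : Continuous φ := by fun_prop
  have hψ : Continuous ψ := by fun_prop
  have hφψ : ∀ x, φ (ψ x) = x := fun x ↦ by
    obtain ⟨c, hc⟩ := Submodule.mem_span_singleton.mp (hπV x)
    have hgc : g (x - π x) = c := by simp [← hc, hg, hv]
    simp [φ, ψ, hP, hgc, hc, -map_sub]
  have hmeagre : IsMeagre (Prod.fst '' (ψ '' A)) := by
    refine isMeagre_image_fst_of_fibre_mem_nhds (hL.preimage hφ) ?_ ?_
    · rintro _ ⟨a, ha, rfl⟩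
      have hlim : Filter.Tendsto (fun s : ℝ ↦ s - (ψ a).2) (nhds (ψ a).2) (nhds 0) :=
        (continuous_sub_right _).tendsto' _ _ (sub_self _)
      filter_upwards [hlim.eventually (hLA.eventually_add_smul_mem ha v)] with s hs
      have h : φ ((ψ a).1, s) = φ (ψ a) + (s - (ψ a).2) • v := by
        simp only [φ]
        module
      rwa [Set.mem_preimage, h, hφψ]
    · rintro _ ⟨a, ha, rfl⟩ hmem
      have hLa : L ∈ nhds a := by
        filter_upwards [hψ.continuousAt.preimage_mem_nhds hmem] with x hx
        simpa [hφψ] using hx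
      have h := hAL ha
      rw [closure_compl] at h
      exact h (mem_interior_iff_mem_nhds.mpr hLa)
  refine hmeagre.mono ?_
  rintro y ⟨a, ha, hay⟩
  exact ⟨ψ a, ⟨a, ha, rfl⟩, Subtype.ext ((hP a).trans hay)⟩
end

section
/- Let X be a separable Banach space with dim X ≥ 2 and let A ⊂ X be an l-miserable set. Then for each c ∈ X \ A, the set {(x − c)/‖x − c‖ : x ∈ A} is a first category (meager) subset of the unit sphere S_X = {x ∈ X : ‖x‖ = 1}. -/
open Topology in
/-- If a segment `c + [p, q] • u` lies in `L` but some interior point of it is adherent to `Lᶜ`,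
then `u` is a boundary point of the set of unit directions for which the segment lies in `L`. -/
theorem mem_frontier_segment_directions {X : Type*} [NormedAddCommGroup X] [NormedSpace ℝ X]
    {L : Set X} {c a : X} (hac : a ≠ c) (ha : a ∈ closure Lᶜ) {p q : ℝ}
    (hpq : ‖a - c‖ ∈ Set.Ioo p q) {u : Metric.sphere (0 : X) 1}
    (hu : ‖a - c‖⁻¹ • (a - c) = u) (hseg : ∀ t ∈ Set.Icc p q, c + t • (u : X) ∈ L) :
    u ∈ frontier {w : Metric.sphere (0 : X) 1 | ∀ t ∈ Set.Icc p q, c + t • (w : X) ∈ L} := by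
  refine ⟨subset_closure hseg, fun hint => ?_⟩
  obtain ⟨U, hU, hUF⟩ := isOpen_induced_iff.1 (isOpen_interior
    (s := {w : Metric.sphere (0 : X) 1 | ∀ t ∈ Set.Icc p q, c + t • (w : X) ∈ L}))
  have huU : ‖a - c‖⁻¹ • (a - c) ∈ U := by
    rw [← hUF] at hint
    rw [hu]
    exact hint
  have hne : ‖a - c‖ ≠ 0 := norm_ne_zero_iff.2 (sub_ne_zero.2 hac)
  have hnorm : ContinuousAt (fun x : X => ‖x - c‖) a := by fun_prop
  have hcont : ContinuousAt (fun x : X => ‖x - c‖⁻¹ • (x - c)) a :=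
    (hnorm.inv₀ hne).smul (by fun_prop)
  have hL : L ∈ 𝓝 a := by
    filter_upwards [hcont (hU.mem_nhds huU), hnorm (Ioo_mem_nhds hpq.1 hpq.2),
      isOpen_ne.mem_nhds hac] with x hxU hxpq hxc
    have hx : ‖x - c‖ ≠ 0 := norm_ne_zero_iff.2 (sub_ne_zero.2 hxc)
    have hw : ‖x - c‖⁻¹ • (x - c) ∈ Metric.sphere (0 : X) 1 := by
      simp [norm_smul, hx]
    have hwF := interior_subset (hUF.subset
      (show (⟨_, hw⟩ : Metric.sphere (0 : X) 1) ∈ Subtype.val ⁻¹' U from hxU))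
    simpa [smul_smul, hx] using hwF ‖x - c‖ (Set.Ioo_subset_Icc_self hxpq)
  obtain ⟨x, hxL, hxL'⟩ := mem_closure_iff_nhds.1 ha L hL
  exact hxL' hxL

theorem isClosed_segment_directions {X : Type*} [NormedAddCommGroup X] [NormedSpace ℝ X]
    {L : Set X} (hL : IsClosed L) (c : X) (p q : ℝ) :
    IsClosed {w : Metric.sphere (0 : X) 1 | ∀ t ∈ Set.Icc p q, c + t • (w : X) ∈ L} := by
  simp only [Set.ofPred_forall]
  exact isClosed_biInter fun t _ => hL.preimage (by fun_prop)

theorem IsClosed.isMeagre_frontier {Y : Type*} [TopologicalSpace Y] {s : Set Y}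
    (hs : IsClosed s) : IsMeagre (frontier s) :=
  residual_of_dense_open isClosed_frontier.isOpen_compl
    (interior_eq_empty_iff_dense_compl.1 (interior_frontier hs))

theorem stmt_10 {X : Type*} [NormedAddCommGroup X] [NormedSpace ℝ X] [CompleteSpace X]
    [TopologicalSpace.SeparableSpace X] (hdim : 2 ≤ Module.rank ℝ X)
    (A : Set X) (hA : IsLMiserable A) (c : X) (hc : c ∉ A) :
    IsMeagre ((Subtype.val ⁻¹' ((fun x => ‖x - c‖⁻¹ • (x - c)) '' A)) :
      Set (Metric.sphere (0 : X) 1)) := by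
  obtain ⟨L, hLc, hLn, hAL⟩ := hA
  refine IsMeagre.mono ?_ (isMeagre_iUnion fun r : ℚ × ℚ =>
    (isClosed_segment_directions hLc c r.1 r.2).isMeagre_frontier)
  rintro u ⟨a, haA, hau⟩
  have hac : a ≠ c := fun h => hc (h ▸ haA)
  have hne : ‖a - c‖ ≠ 0 := norm_ne_zero_iff.2 (sub_ne_zero.2 hac)
  have hau' : ‖a - c‖⁻¹ • (a - c) = u := hau
  have hray (t : ℝ) : c + t • (u : X) = a + (t - ‖a - c‖) • (u : X) := by
    have hu : ‖a - c‖ • (u : X) = a - c := by rw [← hau', smul_inv_smul₀ hne]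
    rw [sub_smul, hu]
    abel
  obtain ⟨ε, hε, hplus⟩ := hLn a haA u
  obtain ⟨δ, hδ, hminus⟩ := hLn a haA (-u)
  obtain ⟨p, hp, hp'⟩ := exists_rat_btwn (sub_lt_self ‖a - c‖ hδ)
  obtain ⟨q, hq, hq'⟩ := exists_rat_btwn (lt_add_of_pos_right ‖a - c‖ hε)
  refine Set.mem_iUnion.2 ⟨(p, q),
    mem_frontier_segment_directions hac (hAL haA) ⟨hp', hq⟩ hau' fun t ht => ?_⟩
  have hpt : (p : ℝ) ≤ t := ht.1
  have htq : t ≤ (q : ℝ) := ht.2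
  rcases le_total ‖a - c‖ t with h | h
  · rw [hray]
    exact hplus _ ⟨by linarith, by linarith⟩
  · rw [hray, ← neg_sub, neg_smul, ← smul_neg]
    exact hminus _ ⟨by linarith, by linarith⟩
end

section
/- Let X be a separable Banach space and M ⊂ X. Then the following are equivalent: (i) M = D(f) for some linearly continuous function f : X → ℝ which has the Baire property, where D(f) is the set of discontinuity points of f; (ii) M is σ̄-l-miserable, i.e. M is a countable union of closed l-miserable sets. -/
open Set Filter Topology

section Necessity

variable {X : Type*} [NormedAddCommGroup X] [NormedSpace ℝ X] {f : X → ℝ}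

lemma LinearlyContinuous.neg (hf : LinearlyContinuous f) : LinearlyContinuous (-f) :=
  fun a v => (hf a v).neg

lemma HasBaireProperty.neg {Y : Type*} [TopologicalSpace Y] {f : Y → ℝ}
    (hf : HasBaireProperty f) : HasBaireProperty (-f) :=
  fun B hB => hf (-B) hB.neg

lemma LinearlyContinuous.tendsto_zero (hf : LinearlyContinuous f) (x v : X) :
    Tendsto (fun t : ℝ => f (x + t • v)) (𝓝 0) (𝓝 (f x)) := by
  simpa using (hf x v).tendsto 0

/-- The set of directions in which `f` stays at most `p` for a definite time from `x`. -/
def lowDirections (f : X → ℝ) (x : X) (p : ℝ) (n : ℕ) : Set X :=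
  {v | ∀ t ∈ Ioo (0 : ℝ) (1 / (n + 1)), f (x + t • v) ≤ p}

/-- The points from which `f` stays at most `p` on a truncated cone with base `B`. -/
def lowConePoints (f : X → ℝ) (B : Set X) (p : ℝ) (n : ℕ) : Set X :=
  {x | B ⊆ lowDirections f x p n}

lemma LinearlyContinuous.iUnion_lowDirections (hf : LinearlyContinuous f) {x : X} {p : ℝ}
    (h : f x < p) : ⋃ n, lowDirections f x p n = univ := by
  refine eq_univ_of_forall fun v => mem_iUnion.2 ?_
  obtain ⟨ε, hε, hball⟩ :=
    Metric.eventually_nhds_iff.1 ((hf.tendsto_zero x v).eventually_lt_const h)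
  obtain ⟨n, hn⟩ := exists_nat_one_div_lt hε
  refine ⟨n, fun t ht => (hball ?_).le⟩
  rw [Real.dist_eq, sub_zero, abs_of_pos ht.1]
  exact ht.2.trans hn

lemma isHomeomorph_add_smul (x : X) {t : ℝ} (ht : t ≠ 0) :
    IsHomeomorph fun v : X => x + t • v :=
  ((Homeomorph.smulOfNeZero t ht).trans (Homeomorph.addLeft x)).isHomeomorph

lemma LinearlyContinuous.baireMeasurableSet_lowDirections (hf : LinearlyContinuous f)
    (hB : HasBaireProperty f) (x : X) (p : ℝ) (n : ℕ) :
    BaireMeasurableSet (lowDirections f x p n) := by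
  have key : lowDirections f x p n =
      ⋂ q : {q : ℚ // (q : ℝ) ∈ Ioo (0 : ℝ) (1 / (n + 1))},
        (fun v : X => x + ((q : ℚ) : ℝ) • v) ⁻¹' (f ⁻¹' Iic p) := by
    ext v
    simp only [lowDirections, mem_ofPred_eq, mem_iInter, mem_preimage, mem_Iic, Subtype.forall]
    refine ⟨fun h q hq => h q hq, fun h t ht => ?_⟩
    have hcl : t ∈ closure (Ioo (0 : ℝ) (1 / (n + 1)) ∩ range ((↑) : ℚ → ℝ)) :=
      Rat.denseRange_cast.open_subset_closure_inter isOpen_Ioo ht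
    refine closure_minimal ?_ (isClosed_le (hf x v) continuous_const) hcl
    rintro _ ⟨hq, q, rfl⟩
    exact h q hq
  rw [key]
  refine BaireMeasurableSet.iInter fun q => ?_
  have hh := isHomeomorph_add_smul x q.2.1.ne'
  exact (hB _ measurableSet_Iic).preimage hh.continuous hh.isOpenMap

lemma LinearlyContinuous.exists_isOpen_residual_lowDirections [CompleteSpace X]
    (hf : LinearlyContinuous f) (hB : HasBaireProperty f) {x : X} {p : ℝ} (h : f x < p) :
    ∃ V : Set X, IsOpen V ∧ V.Nonempty ∧
      ∃ n : ℕ, ∀ᶠ v in residual X, v ∈ V → v ∈ lowDirections f x p n := by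
  obtain ⟨n, hn⟩ : ∃ n, ¬ IsMeagre (lowDirections f x p n) := by
    by_contra! hm
    have := isMeagre_iUnion hm
    rw [hf.iUnion_lowDirections h] at this
    exact not_isMeagre_of_isOpen isOpen_univ univ_nonempty this
  obtain ⟨U, hU, hKU⟩ := (hf.baireMeasurableSet_lowDirections hB x p n).residualEq_isOpen
  refine ⟨U, hU, ?_, n, ?_⟩
  · rw [nonempty_iff_ne_empty]
    rintro rfl
    refine hn ?_
    filter_upwards [eventuallyEq_set.1 hKU] with v hv using fun hvK => hv.1 hvK
  · filter_upwards [eventuallyEq_set.1 hKU] with v hv using hv.2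

lemma LinearlyContinuous.exists_isOpen_subset_lowDirections [CompleteSpace X]
    (hf : LinearlyContinuous f) (hB : HasBaireProperty f) {x : X} {p : ℝ} (h : f x < p) :
    ∃ V : Set X, IsOpen V ∧ V.Nonempty ∧ ∃ n : ℕ, V ⊆ lowDirections f x p n := by
  obtain ⟨V, hV, hVne, n, hres⟩ := hf.exists_isOpen_residual_lowDirections hB h
  refine ⟨V, hV, hVne, n, fun v hv t ht => ?_⟩
  by_contra! hlt
  obtain ⟨p', hpp', hp'⟩ := exists_between hlt
  obtain ⟨W, hW, ⟨w₀, hw₀⟩, m, hres'⟩ :=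
    hf.neg.exists_isOpen_residual_lowDirections hB.neg (x := x + t • v) (p := -p')
      (by simpa using hp')
  have hlim : Tendsto (fun s : ℝ => v + (s / t) • w₀) (𝓝 0) (𝓝 v) := by
    have : Continuous fun s : ℝ => v + (s / t) • w₀ := by fun_prop
    simpa using this.tendsto 0
  have hm : (0 : ℝ) < 1 / (m + 1) := by positivity
  obtain ⟨s, hsV, hs⟩ := (((hlim.mono_left nhdsWithin_le_nhds).eventually
    (hV.mem_nhds hv)).and (Ioo_mem_nhdsGT hm)).exists
  have hh := isHomeomorph_add_smul v (div_pos hs.1 ht.1).ne'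
  have hopen : IsOpen (W ∩ (fun w : X => v + (s / t) • w) ⁻¹' V) :=
    hW.inter (hV.preimage hh.continuous)
  have hres'' := (tendsto_residual_of_isOpenMap hh.continuous hh.isOpenMap).eventually hres
  obtain ⟨w, ⟨hwW, hwV⟩, hw', hw⟩ :=
    (dense_of_mem_residual (hres'.and hres'')).inter_open_nonempty _ hopen ⟨w₀, hw₀, hsV⟩
  have h1 : -f (x + t • v + s • w) ≤ -p' := hw' hwW s hs
  have h2 : f (x + t • (v + (s / t) • w)) ≤ p := hw hwV t ht
  have heq : x + t • (v + (s / t) • w) = x + t • v + s • w := by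
    rw [smul_add, smul_smul, mul_div_cancel₀ _ ht.1.ne', add_assoc]
  rw [heq] at h2
  linarith

/-- Linearly continuous functions with the Baire property are quasi-continuous. -/
lemma LinearlyContinuous.mem_closure_interior [CompleteSpace X]
    (hf : LinearlyContinuous f) (hB : HasBaireProperty f) {x : X} {q : ℝ} (h : q < f x) :
    x ∈ closure (interior {y | q ≤ f y}) := by
  obtain ⟨V, hV, ⟨v, hv⟩, n, hVn⟩ :=
    hf.neg.exists_isOpen_subset_lowDirections hB.neg (x := x) (p := -q) (by simpa using h)
  have hlim : Tendsto (fun s : ℝ => x + s • v) (𝓝[>] 0) (𝓝 x) := by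
    have : Continuous fun s : ℝ => x + s • v := by fun_prop
    simpa using (this.tendsto 0).mono_left nhdsWithin_le_nhds
  have hn : (0 : ℝ) < 1 / (n + 1) := by positivity
  refine mem_closure_of_tendsto hlim ?_
  filter_upwards [Ioo_mem_nhdsGT hn] with t ht
  refine mem_interior.2 ⟨(fun v : X => x + t • v) '' V, ?_,
    (isHomeomorph_add_smul x ht.1.ne').isOpenMap V hV, mem_image_of_mem _ hv⟩
  rintro _ ⟨w, hw, rfl⟩
  have : -f (x + t • w) ≤ -q := hVn hw t ht
  exact neg_le_neg_iff.1 this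

lemma isClosed_lowConePoints {B : Set X} (hB : IsOpen B) (p : ℝ) (n : ℕ) :
    IsClosed (lowConePoints f B p n) := by
  refine isClosed_of_closure_subset fun x hx v hv t ht => ?_
  have hlim : Tendsto (fun y : X => v + t⁻¹ • (x - y)) (𝓝 x) (𝓝 v) := by
    have : Continuous fun y : X => v + t⁻¹ • (x - y) := by fun_prop
    simpa using this.tendsto x
  obtain ⟨y, hy, hyB⟩ :=
    ((mem_closure_iff_frequently.1 hx).and_eventually (hlim.eventually (hB.mem_nhds hv))).exists
  have := hy hyB t ht
  rwa [smul_add, smul_inv_smul₀ ht.1.ne', add_comm (t • v), ← add_assoc, add_sub_cancel] at this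

lemma LinearlyContinuous.le_of_mem_lowConePoints (hf : LinearlyContinuous f) {B : Set X}
    (hB : B.Nonempty) {p : ℝ} {n : ℕ} {x : X} (hx : x ∈ lowConePoints f B p n) : f x ≤ p := by
  obtain ⟨v, hv⟩ := hB
  have hn : (0 : ℝ) < 1 / (n + 1) := by positivity
  refine le_of_tendsto ((hf.tendsto_zero x v).mono_left (nhdsWithin_le_nhds (s := Ioi 0))) ?_
  filter_upwards [Ioo_mem_nhdsGT hn] with t ht using hx hv t ht

lemma LinearlyContinuous.isLMiserable_of_subset (hf : LinearlyContinuous f) {A : Set X} {q : ℝ}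
    (h : A ⊆ {x | f x < q}) (h' : A ⊆ closure (interior {y | q ≤ f y})) : IsLMiserable A := by
  refine ⟨closure {x | f x < q}, isClosed_closure, fun a ha v => ?_, ?_⟩
  · obtain ⟨ε, hε, hball⟩ :=
      Metric.eventually_nhds_iff.1 ((hf.tendsto_zero a v).eventually_lt_const (h ha))
    refine ⟨ε, hε, fun t ht => subset_closure (hball ?_)⟩
    rw [Real.dist_eq, sub_zero, abs_of_nonneg ht.1]
    exact ht.2
  · rw [← interior_compl]
    convert h' using 4
    ext x
    simp

lemma not_continuousAt_of_mem_closure {Y : Type*} [TopologicalSpace Y] {f : Y → ℝ} {q : ℝ} {x : Y}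
    (h : f x < q) (h' : x ∈ closure {y | q ≤ f y}) : ¬ ContinuousAt f x := fun hc => by
  obtain ⟨y, hy, hy'⟩ :=
    ((mem_closure_iff_frequently.1 h').and_eventually (hc.eventually_lt_const h)).exists
  exact absurd hy' (not_lt.2 hy)

lemma LinearlyContinuous.exists_isLMiserable_cover [CompleteSpace X]
    [TopologicalSpace.SeparableSpace X] (hf : LinearlyContinuous f) (hB : HasBaireProperty f) :
    ∃ A : ℕ → Set X, (∀ n, IsClosed (A n) ∧ IsLMiserable (A n)) ∧
      (∀ n, ∀ x ∈ A n, ¬ ContinuousAt f x) ∧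
      ∀ x q, f x < q → x ∈ closure {y | q < f y} → ∃ n, x ∈ A n := by
  have : SecondCountableTopology X := UniformSpace.secondCountable_of_separable X
  have hbasis := TopologicalSpace.isBasis_countableBasis X
  have : Countable (TopologicalSpace.countableBasis X) :=
    (TopologicalSpace.countable_countableBasis X).to_subtype
  have : Nonempty (TopologicalSpace.countableBasis X) := by
    obtain ⟨U, hU, -⟩ := hbasis.exists_subset_of_mem_open (mem_univ (0 : X)) isOpen_univ
    exact ⟨U, hU⟩
  obtain ⟨e, he⟩ := exists_surjective_nat (TopologicalSpace.countableBasis X × ℕ × ℚ × ℚ)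
  let A : TopologicalSpace.countableBasis X × ℕ × ℚ × ℚ → Set X := fun i =>
    {_x | i.2.2.1 < i.2.2.2} ∩ (lowConePoints f i.1 i.2.2.1 i.2.1 ∩
      closure (interior {y | (i.2.2.2 : ℝ) ≤ f y}))
  have hlt : ∀ i, ∀ x ∈ A i, f x < i.2.2.2 := fun i x hx =>
    (hf.le_of_mem_lowConePoints (TopologicalSpace.nonempty_of_mem_countableBasis i.1.2)
      hx.2.1).trans_lt (Rat.cast_lt.2 hx.1)
  refine ⟨fun n => A (e n), fun n => ⟨?_, ?_⟩, fun n x hx => ?_, fun x q hq hx => ?_⟩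
  · exact isClosed_const.inter ((isClosed_lowConePoints
      (TopologicalSpace.isOpen_of_mem_countableBasis (e n).1.2) _ _).inter isClosed_closure)
  · exact hf.isLMiserable_of_subset (hlt _) fun x hx => hx.2.2
  · exact not_continuousAt_of_mem_closure (hlt _ x hx) (closure_mono interior_subset hx.2.2)
  · obtain ⟨r, hxr, hrq⟩ := exists_rat_btwn hq
    obtain ⟨p, hxp, hpr⟩ := exists_rat_btwn hxr
    obtain ⟨V, hV, ⟨v, hv⟩, n, hVn⟩ := hf.exists_isOpen_subset_lowDirections hB hxp
    obtain ⟨U, hU, -, hUV⟩ := hbasis.exists_subset_of_mem_open hv hV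
    obtain ⟨k, hk⟩ := he (⟨U, hU⟩, n, p, r)
    refine ⟨k, ?_⟩
    simp only [hk]
    refine ⟨Rat.cast_lt.1 hpr, hUV.trans hVn, ?_⟩
    exact closure_minimal (fun y hy => hf.mem_closure_interior hB (hrq.trans hy))
      isClosed_closure hx

lemma exists_mem_closure_of_not_continuousAt {Y : Type*} [TopologicalSpace Y] {f : Y → ℝ} {x : Y}
    (h : ¬ ContinuousAt f x) :
    (∃ q, f x < q ∧ x ∈ closure {y | q < f y}) ∨
      ∃ q, (-f) x < q ∧ x ∈ closure {y | q < (-f) y} := by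
  rw [ContinuousAt, tendsto_order] at h
  by_contra! hcon
  refine h ⟨fun a ha => ?_, fun a ha => ?_⟩
  · obtain ⟨q, haq, hq⟩ := exists_between ha
    have := hcon.2 (-q) (by simpa using hq)
    rw [mem_closure_iff_frequently, not_frequently] at this
    filter_upwards [this] with y hy
    have : q ≤ f y := by simpa using hy
    exact haq.trans_le this
  · obtain ⟨q, hq, hqa⟩ := exists_between ha
    have := hcon.1 q hq
    rw [mem_closure_iff_frequently, not_frequently] at this
    filter_upwards [this] with y hy
    exact (not_lt.1 hy).trans_lt hqa

lemma LinearlyContinuous.exists_isLMiserable_iUnion_eq [CompleteSpace X]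
    [TopologicalSpace.SeparableSpace X] (hf : LinearlyContinuous f) (hB : HasBaireProperty f) :
    ∃ A : ℕ → Set X, (∀ n, IsClosed (A n) ∧ IsLMiserable (A n)) ∧
      {x | ¬ ContinuousAt f x} = ⋃ n, A n := by
  obtain ⟨A, hA, hAD, hAc⟩ := hf.exists_isLMiserable_cover hB
  obtain ⟨A', hA', hAD', hAc'⟩ := hf.neg.exists_isLMiserable_cover hB.neg
  obtain ⟨e, he⟩ := exists_surjective_nat (ℕ ⊕ ℕ)
  refine ⟨fun n => Sum.elim A A' (e n), fun n => ?_, Subset.antisymm (fun x hx => ?_) ?_⟩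
  · change IsClosed (Sum.elim A A' (e n)) ∧ IsLMiserable (Sum.elim A A' (e n))
    rcases e n with k | k
    exacts [hA k, hA' k]
  · rw [he.iUnion_comp (Sum.elim A A'), mem_iUnion]
    rcases exists_mem_closure_of_not_continuousAt hx with ⟨q, hq, hq'⟩ | ⟨q, hq, hq'⟩
    · obtain ⟨n, hn⟩ := hAc x q hq hq'
      exact ⟨Sum.inl n, hn⟩
    · obtain ⟨n, hn⟩ := hAc' x q hq hq'
      exact ⟨Sum.inr n, hn⟩
  · refine iUnion_subset fun n x hx hc => ?_
    rcases hk : e n with k | k <;> rw [hk] at hx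
    exacts [hAD k x hx hc, hAD' k x hx hc.neg]

end Necessity

section Sufficiency

/-- In a separable metric space, a closed subset of the boundary of an open set `U` is the
discontinuity set of a function supported in `U` with oscillation one on that subset. -/
lemma exists_oscillating_on {X : Type*} [MetricSpace X] [TopologicalSpace.SeparableSpace X]
    {A U : Set X} (hA : IsClosed A) (hU : IsOpen U) (hAU : Disjoint A U) (hcl : A ⊆ closure U) :
    ∃ f : X → ℝ, (∀ x, f x ∈ Icc (0 : ℝ) 1) ∧ (∀ x ∉ U, f x = 0) ∧
      (∀ x ∉ A, ContinuousAt f x) ∧ ∀ x ∈ A, ∃ᶠ y in 𝓝 x, f y = 1 := by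
  rcases A.eq_empty_or_nonempty with rfl | hne
  · exact ⟨0, by simp, by simp, fun x _ => continuousAt_const, by simp⟩
  have : Nonempty A := hne.to_subtype
  have : SecondCountableTopology X := UniformSpace.secondCountable_of_separable X
  let a : ℕ → A := fun j => TopologicalSpace.denseSeq A j.unpair.1
  have hpos : ∀ j : ℕ, (0 : ℝ) < 1 / (j + 1) := fun j => by positivity
  have hx : ∀ j : ℕ, ∃ x ∈ U, dist (a j : X) x < 1 / (j + 1) := fun j =>
    Metric.mem_closure_iff.1 (hcl (a j).2) _ (hpos j)
  choose c hcU hca using hx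
  have hr : ∀ j : ℕ, ∃ r > 0, r ≤ 1 / ((j : ℝ) + 1) ∧ Metric.ball (c j) r ⊆ U := fun j => by
    obtain ⟨r, hr, hrU⟩ := Metric.isOpen_iff.1 hU _ (hcU j)
    exact ⟨min r (1 / (j + 1)), lt_min hr (hpos j), min_le_right _ _,
      (Metric.ball_subset_ball (min_le_left _ _)).trans hrU⟩
  choose r hr0 hr1 hrU using hr
  let φ : ℕ → X → ℝ := fun j y => max 0 (1 - dist y (c j) / r j)
  have hφ0 : ∀ j y, 0 ≤ φ j y := fun j y => le_max_left _ _
  have hφc : ∀ j, Continuous (φ j) := fun j => by fun_prop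
  have hφ1 : ∀ j, φ j (c j) = 1 := fun j => by simp [φ]
  have hφball : ∀ j y, φ j y ≠ 0 → dist y (c j) < r j := fun j y hy => by
    by_contra! hd
    refine hy (max_eq_left ?_)
    rw [sub_nonpos, one_le_div (hr0 j)]
    exact hd
  have hφU : ∀ y ∉ U, ∀ j, φ j y = 0 := fun y hy j => by
    by_contra hne
    exact hy (hrU j (hφball j y hne))
  have hlf : ∀ x ∉ A, ∃ N : ℕ, ∀ᶠ y in 𝓝 x, ∀ j ∉ Finset.range N, φ j y = 0 := fun x hx => by
    obtain ⟨δ, hδ, hδA⟩ := Metric.isOpen_iff.1 hA.isOpen_compl x hx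
    obtain ⟨N, hN⟩ := exists_nat_one_div_lt (show 0 < δ / 3 by positivity)
    refine ⟨N, ?_⟩
    filter_upwards [Metric.ball_mem_nhds x (show 0 < δ / 3 by positivity)] with y hy j hj
    by_contra hne
    have h1 := hφball j y hne
    have h2 : 1 / ((j : ℝ) + 1) ≤ 1 / (N + 1) :=
      one_div_le_one_div_of_le (by positivity) (by simpa using hj)
    have h3 := hr1 j
    have h4 := hca j
    have h5 := Metric.mem_ball.1 hy
    have h7 : dist (a j : X) x ≤ dist (a j : X) (c j) + dist y (c j) + dist y x := by
      have := dist_triangle4 (a j : X) (c j) y x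
      rwa [dist_comm (c j) y] at this
    exact hδA (Metric.mem_ball.2 (by linarith)) (a j).2
  refine ⟨fun y => min 1 (∑' j, φ j y), fun y => ⟨?_, min_le_left _ _⟩, fun y hy => ?_,
    fun x hx => ?_, fun x hx => ?_⟩
  · exact le_min zero_le_one (tsum_nonneg fun j => hφ0 j y)
  · simp [hφU y hy]
  · obtain ⟨N, hN⟩ := hlf x hx
    refine continuousAt_const.min ?_
    have hs : ContinuousAt (fun y => ∑ j ∈ Finset.range N, φ j y) x :=
      (continuous_finsetSum _ fun j _ => hφc j).continuousAt
    refine hs.congr ?_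
    filter_upwards [hN] with y hy using (tsum_eq_sum hy).symm
  · have hval : ∀ j, min 1 (∑' i, φ i (c j)) = 1 := fun j => by
      refine min_eq_left ?_
      obtain ⟨N, hN⟩ := hlf (c j) fun h => disjoint_left.1 hAU h (hcU j)
      have hsum : Summable fun i => φ i (c j) :=
        summable_of_ne_finset_zero (s := Finset.range N) hN.self_of_nhds
      exact (hφ1 j).ge.trans (hsum.le_tsum j fun i _ => hφ0 i _)
    rw [Metric.nhds_basis_ball.frequently_iff]
    intro ε hε
    obtain ⟨k, hk⟩ := Metric.denseRange_iff.1 (TopologicalSpace.denseRange_denseSeq A)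
      ⟨x, hx⟩ (ε / 2) (by positivity)
    obtain ⟨m, hm⟩ := exists_nat_one_div_lt (show 0 < ε / 2 by positivity)
    refine ⟨c (Nat.pair k m), Metric.mem_ball.2 ?_, hval _⟩
    have h1 := hca (Nat.pair k m)
    have h2 : 1 / ((Nat.pair k m : ℕ) + 1 : ℝ) ≤ 1 / (m + 1) :=
      one_div_le_one_div_of_le (by positivity)
        (by have := Nat.right_le_pair k m; gcongr)
    have h3 : dist x (a (Nat.pair k m) : X) < ε / 2 := by
      simpa [a, Subtype.dist_eq] using hk
    have h4 := dist_triangle x (a (Nat.pair k m) : X) (c (Nat.pair k m))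
    rw [dist_comm]
    linarith

lemma linearlyContinuous_of_isLNeighborhood {X : Type*} [NormedAddCommGroup X] [NormedSpace ℝ X]
    {f : X → ℝ} {A L : Set X} (hL : IsLNeighborhood L A) (hf0 : ∀ x ∈ L, f x = 0)
    (hfc : ∀ x ∉ A, ContinuousAt f x) : LinearlyContinuous f := by
  refine fun a v => continuous_iff_continuousAt.2 fun s => ?_
  by_cases hs : a + s • v ∈ A
  · obtain ⟨ε, hε, hε'⟩ := hL _ hs v
    obtain ⟨δ, hδ, hδ'⟩ := hL _ hs (-v)
    have hev : (fun _ => 0) =ᶠ[𝓝 s] fun t : ℝ => f (a + t • v) := by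
      filter_upwards [Ioo_mem_nhds (show s - δ < s by linarith) (show s < s + ε by linarith)]
        with t ht
      rcases le_total s t with h | h
      · have := hf0 _ (hε' (t - s) ⟨by linarith, by linarith [ht.2]⟩)
        rw [add_assoc, ← add_smul, add_sub_cancel] at this
        exact this.symm
      · have := hf0 _ (hδ' (s - t) ⟨by linarith, by linarith [ht.1]⟩)
        rw [add_assoc, smul_neg, ← neg_smul, ← add_smul, neg_sub, add_sub_cancel] at this
        exact this.symm
    exact continuousAt_const.congr hev
  · exact ContinuousAt.comp (f := fun t : ℝ => a + t • v) (hfc _ hs) (by fun_prop)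

variable {X : Type*} [NormedAddCommGroup X] [NormedSpace ℝ X]

lemma IsLMiserable.exists_linearlyContinuous [TopologicalSpace.SeparableSpace X]
    {A : Set X} (hA : IsClosed A) (hm : IsLMiserable A) :
    ∃ f : X → ℝ, LinearlyContinuous f ∧ (∀ x, f x ∈ Icc (0 : ℝ) 1) ∧ (∀ x ∈ A, f x = 0) ∧
      (∀ x ∉ A, ContinuousAt f x) ∧ ∀ x ∈ A, ∃ᶠ y in 𝓝 x, f y = 1 := by
  obtain ⟨L, hLc, hL, hAL⟩ := hm
  have hsub : A ⊆ L := fun a ha => by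
    obtain ⟨ε, hε, h⟩ := hL a ha 0
    simpa using h 0 ⟨le_rfl, hε⟩
  obtain ⟨f, hf01, hf0, hfc, hf1⟩ := exists_oscillating_on hA hLc.isOpen_compl
    (disjoint_compl_right_iff_subset.2 hsub) hAL
  have hfL : ∀ x ∈ L, f x = 0 := fun x hx => hf0 x (not_not.2 hx)
  exact ⟨f, linearlyContinuous_of_isLNeighborhood hL hfL hfc, hf01,
    fun x hx => hfL x (hsub hx), hfc, hf1⟩

lemma hasBaireProperty_of_measurable {Y : Type*} [TopologicalSpace Y] [MeasurableSpace Y]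
    [BorelSpace Y] {f : Y → ℝ} (hf : Measurable f) : HasBaireProperty f :=
  fun _ hB => (hf hB).baireMeasurableSet

lemma exists_linearlyContinuous_of_iUnion [TopologicalSpace.SeparableSpace X]
    {A : ℕ → Set X} (hA : ∀ n, IsClosed (A n) ∧ IsLMiserable (A n)) :
    ∃ f : X → ℝ, LinearlyContinuous f ∧ HasBaireProperty f ∧
      {x | ¬ ContinuousAt f x} = ⋃ n, A n := by
  choose f hlin h01 h0 hcont h1 using fun n => (hA n).2.exists_linearlyContinuous (hA n).1
  have hgeo : Summable fun n : ℕ => (1 / 3 : ℝ) ^ n :=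
    summable_geometric_of_lt_one (by norm_num) (by norm_num)
  let g : ℕ → X → ℝ := fun n x => (1 / 3 : ℝ) ^ n * f n x
  have hg0 : ∀ n x, 0 ≤ g n x := fun n x => mul_nonneg (by positivity) (h01 n x).1
  have hg1 : ∀ n x, g n x ≤ (1 / 3 : ℝ) ^ n := fun n x =>
    mul_le_of_le_one_right (by positivity) (h01 n x).2
  have hgn : ∀ n x, ‖g n x‖ ≤ (1 / 3 : ℝ) ^ n := fun n x => by
    rw [Real.norm_of_nonneg (hg0 n x)]
    exact hg1 n x
  have hsum : ∀ x, Summable fun n => g n x := fun x => .of_norm_bounded hgeo fun n => hgn n x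
  have hgc : ∀ n, ∀ x ∉ A n, ContinuousAt (g n) x := fun n x hx =>
    continuousAt_const.mul (hcont n x hx)
  refine ⟨fun x => ∑' n, g n x, fun a v => ?_, ?_, Subset.antisymm (fun x hx => ?_) ?_⟩
  · exact continuous_tsum (fun n => (hlin n a v).const_mul _) hgeo fun n t => hgn n _
  · borelize X
    refine hasBaireProperty_of_measurable ?_
    have hmeas : ∀ n, Measurable (g n) := fun n => by
      classical
      have hm := ContinuousOn.measurable_piecewise (s := A n) (f := 0) (g := f n)
        continuousOn_const (fun x hx => (hcont n x hx).continuousWithinAt) (hA n).1.measurableSet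
      have heq : (A n).piecewise (0 : X → ℝ) (f n) = f n := by
        ext x
        by_cases hx : x ∈ A n <;> simp [hx, h0]
      rw [heq] at hm
      exact hm.const_mul _
    refine measurable_of_tendsto_metrizable
      (f := fun N x => ∑ n ∈ Finset.range N, g n x)
      (fun N => Finset.measurable_fun_sum _ fun n _ => hmeas n) ?_
    exact tendsto_pi_nhds.2 fun x => (hsum x).hasSum.tendsto_sum_nat
  · by_contra hxA
    refine hx (tendsto_tsum_of_dominated_convergence hgeo (fun n => ?_)
      (Eventually.of_forall fun y n => hgn n y))
    exact hgc n x fun h => hxA (mem_iUnion.2 ⟨n, h⟩)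
  · intro x hx hc
    classical
    have hex := mem_iUnion.1 hx
    have hmem := Nat.find_spec hex
    have hmin : ∀ k < Nat.find hex, x ∉ A k := fun k hk => Nat.find_min hex hk
    generalize Nat.find hex = n at hmem hmin
    have hhead : ContinuousAt (fun y => ∑ k ∈ Finset.range n, g k y) x :=
      tendsto_finsetSum _ fun k hk => hgc k x (hmin k (Finset.mem_range.1 hk))
    have htail : ContinuousAt (fun y => ∑' k, g (k + n) y) x := by
      refine (hc.sub hhead).congr (Eventually.of_forall fun y => ?_)
      exact sub_eq_of_eq_add' ((hsum y).sum_add_tsum_nat_add n).symm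
    have hsum' : ∀ y, Summable fun k => g (k + n) y := fun y =>
      (summable_nat_add_iff n).2 (hsum y)
    have hlow : ∃ᶠ y in 𝓝 x, (1 / 3 : ℝ) ^ n ≤ ∑' k, g (k + n) y := by
      refine (h1 n x hmem).mono fun y hy => ?_
      have := (hsum' y).le_tsum 0 fun k _ => hg0 _ y
      simpa [g, hy] using this
    have hup : ∑' k, g (k + n) x < (1 / 3 : ℝ) ^ n := by
      rw [(hsum' x).tsum_eq_zero_add]
      have hz : g (0 + n) x = 0 := by simp [g, h0 n x hmem]
      have hle : ∑' k, g (k + 1 + n) x ≤ ∑' k : ℕ, (1 / 3 : ℝ) ^ k * (1 / 3) ^ (n + 1) := by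
        refine Summable.tsum_le_tsum (fun k => ?_) ((summable_nat_add_iff 1).2 (hsum' x))
          (hgeo.mul_right _)
        rw [← pow_add, show k + (n + 1) = k + 1 + n by ring]
        exact hg1 _ x
      rw [tsum_mul_right, tsum_geometric_of_lt_one (by norm_num) (by norm_num), pow_succ] at hle
      have : (0 : ℝ) < (1 / 3) ^ n := by positivity
      rw [hz]
      linarith
    obtain ⟨y, hy, hy'⟩ := (hlow.and_eventually (htail.eventually_lt_const hup)).exists
    exact absurd hy' (not_lt.2 hy)

end Sufficiency

theorem stmt_11 {X : Type*} [NormedAddCommGroup X] [NormedSpace ℝ X] [CompleteSpace X]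
    [TopologicalSpace.SeparableSpace X] (M : Set X) :
    (∃ f : X → ℝ, LinearlyContinuous f ∧ HasBaireProperty f ∧
        {x : X | ¬ ContinuousAt f x} = M) ↔
      (∃ A : ℕ → Set X, (∀ n, IsClosed (A n) ∧ IsLMiserable (A n)) ∧ M = ⋃ n, A n) := by
  constructor
  · rintro ⟨f, hf, hB, rfl⟩
    exact hf.exists_isLMiserable_iUnion_eq hB
  · rintro ⟨A, hA, rfl⟩
    exact exists_linearlyContinuous_of_iUnion hA
end

section
/- Let n ≥ 2, let f : ℝ^{n−1} → ℝ be a convex function, and let M ⊂ graph f = {(x, f(x)) : x ∈ ℝ^{n−1}} ⊂ ℝⁿ be nowhere dense in graph f (with the subspace topology). Then there exists a linearly continuous function g : ℝⁿ → ℝ such that M ⊂ D(g), where D(g) is the set of discontinuity points of g. -/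
open Set Filter Topology Metric

/-- The tent-like bump `max 0 (s * (1 - s))`, evaluated at the height of `p` above the graph of `f`
in units of the squared distance of `p.1` to `N`. -/
noncomputable def graphBump {E : Type*} [NormedAddCommGroup E] (f : E → ℝ) (N : Set E)
    (p : E × ℝ) : ℝ :=
  max 0 ((p.2 - f p.1) / infDist p.1 N ^ 2 * (1 - (p.2 - f p.1) / infDist p.1 N ^ 2))

section graphBump

variable {E : Type*} [NormedAddCommGroup E] {f : E → ℝ} {N : Set E} {p : E × ℝ}

theorem mem_region_of_graphBump_ne_zero (h : graphBump f N p ≠ 0) :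
    0 < p.2 - f p.1 ∧ p.2 - f p.1 < infDist p.1 N ^ 2 := by
  have hd : 0 < infDist p.1 N ^ 2 := by
    refine lt_of_le_of_ne (sq_nonneg _) fun h0 => h ?_
    simp [graphBump, ← h0]
  have hpos : 0 < (p.2 - f p.1) / infDist p.1 N ^ 2 *
      (1 - (p.2 - f p.1) / infDist p.1 N ^ 2) := by
    by_contra! hle
    exact h (max_eq_left hle)
  set s := (p.2 - f p.1) / infDist p.1 N ^ 2 with hs
  have hs0 : 0 < s := by nlinarith [sq_nonneg s]
  have hs1 : s < 1 := by nlinarith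
  exact ⟨(div_pos_iff_of_pos_right hd).1 hs0, (div_lt_one hd).1 hs1⟩

theorem graphBump_midpoint {x : E} (hx : infDist x N ≠ 0) :
    graphBump f N (x, f x + infDist x N ^ 2 / 2) = 1 / 4 := by
  have : infDist x N ^ 2 / 2 / infDist x N ^ 2 = 1 / 2 := by field_simp
  simp only [graphBump, add_sub_cancel_left, this]
  norm_num

theorem graphBump_continuousAt (hf : Continuous f)
    (hp : infDist p.1 N ≠ 0 ∨ p.2 ≠ f p.1) : ContinuousAt (graphBump f N) p := by
  have hd : Continuous fun q : E × ℝ => infDist q.1 N :=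
    (continuous_infDist_pt N).comp continuous_fst
  have hh : Continuous fun q : E × ℝ => q.2 - f q.1 := by fun_prop
  by_cases h0 : infDist p.1 N = 0
  · have hne : p.2 - f p.1 ≠ 0 := sub_ne_zero.2 (hp.resolve_left (not_not.2 h0))
    have hev : ∀ᶠ q : E × ℝ in 𝓝 p, infDist q.1 N ^ 2 < |q.2 - f q.1| :=
      (hd.pow 2).continuousAt.eventually_lt hh.abs.continuousAt (by simpa [h0] using hne)
    have hz : graphBump f N =ᶠ[𝓝 p] fun _ => 0 := by
      filter_upwards [hev] with q hq
      by_contra hne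
      obtain ⟨h1, h2⟩ := mem_region_of_graphBump_ne_zero hne
      rw [abs_of_pos h1] at hq
      exact lt_asymm h2 hq
    exact continuousAt_const.congr hz.symm
  · have hq : ContinuousAt (fun q : E × ℝ => (q.2 - f q.1) / infDist q.1 N ^ 2) p :=
      hh.continuousAt.div (hd.pow 2).continuousAt (pow_ne_zero 2 h0)
    exact continuousAt_const.max (hq.mul (continuousAt_const.sub hq))

theorem not_continuousAt_graphBump (hf : Continuous f) (hN : IsNowhereDense N) {x : E}
    (hx : x ∈ N) : ¬ ContinuousAt (graphBump f N) (x, f x) := by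
  intro hc
  have hF : Continuous fun z : E => (z, f z + infDist z N ^ 2 / 2) := by
    have := continuous_infDist_pt N
    fun_prop
  have hFx : (x, f x + infDist x N ^ 2 / 2) = (x, f x) := by simp [infDist_zero_of_mem hx]
  have hcomp : ContinuousAt (fun z => graphBump f N (z, f z + infDist z N ^ 2 / 2)) x :=
    ContinuousAt.comp (g := graphBump f N) (f := fun z : E => (z, f z + infDist z N ^ 2 / 2))
      (by rwa [hFx]) hF.continuousAt
  have h0 : graphBump f N (x, f x + infDist x N ^ 2 / 2) = 0 := by
    rw [hFx]; simp [graphBump]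
  have hev := hcomp.eventually_lt (continuousAt_const (y := (1 / 4 : ℝ)))
    (by rw [h0]; norm_num)
  have hmem : x ∈ interior (closure N) := by
    rw [mem_interior_iff_mem_nhds]
    filter_upwards [hev] with z hz
    rw [mem_closure_iff_infDist_zero ⟨x, hx⟩]
    by_contra hne
    exact (graphBump_midpoint (f := f) hne ▸ hz).false
  rw [hN] at hmem
  exact hmem

variable [NormedSpace ℝ E]

theorem eventually_graphBump_eq_zero_right (hconv : ConvexOn ℝ univ f)
    (hd : infDist p.1 N = 0) (hp : p.2 = f p.1) (v : E × ℝ) :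
    ∀ᶠ t : ℝ in 𝓝[>] 0, graphBump f N (p + t • v) = 0 := by
  by_cases hex : ∃ t₀ > (0 : ℝ), 0 < (p + t₀ • v).2 - f (p + t₀ • v).1
  · obtain ⟨t₀, ht₀, hpos⟩ := hex
    set c := (p + t₀ • v).2 - f (p + t₀ • v).1 with hc
    have hsmall : ∀ᶠ t : ℝ in 𝓝[>] 0, t * ‖v.1‖ ^ 2 < c / t₀ := by
      refine nhdsWithin_le_nhds (ContinuousAt.eventually_lt (by fun_prop) continuousAt_const ?_)
      simpa using div_pos hpos ht₀
    filter_upwards [hsmall, Ioo_mem_nhdsGT ht₀] with t ht htI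
    by_contra hne
    obtain ⟨-, hlt⟩ := mem_region_of_graphBump_ne_zero hne
    have hdist : infDist (p + t • v).1 N ≤ t * ‖v.1‖ := by
      calc infDist (p + t • v).1 N ≤ infDist p.1 N + dist (p + t • v).1 p.1 :=
            infDist_le_infDist_add_dist
        _ = t * ‖v.1‖ := by simp [hd, dist_eq_norm, norm_smul, abs_of_pos htI.1]
    have ha : 0 ≤ 1 - t / t₀ := sub_nonneg.2 ((div_le_one ht₀).2 htI.2.le)
    have hcv := hconv.2 (mem_univ p.1) (mem_univ (p + t₀ • v).1) ha
      (div_pos htI.1 ht₀).le (by ring)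
    have hpt : (1 - t / t₀) • p.1 + (t / t₀) • (p + t₀ • v).1 = (p + t • v).1 := by
      simp only [Prod.fst_add, Prod.smul_fst, smul_add, smul_smul, div_mul_cancel₀ t ht₀.ne',
        sub_smul, one_smul]
      abel
    rw [hpt] at hcv
    have hlow : t * (c / t₀) ≤ (p + t • v).2 - f (p + t • v).1 := by
      have e : t * (c / t₀) = t / t₀ * (p + t₀ • v).2 - t / t₀ * f (p + t₀ • v).1 := by
        rw [hc]; ring
      have e2 : t / t₀ * (p + t₀ • v).2 = t / t₀ * p.2 + t * v.2 := by
        simp only [Prod.snd_add, Prod.smul_snd, smul_eq_mul]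
        field_simp
      have e3 : (p + t • v).2 = p.2 + t * v.2 := by simp
      simp only [smul_eq_mul] at hcv
      rw [e, e2, e3]
      rw [hp]
      linarith
    have hsq : infDist (p + t • v).1 N ^ 2 ≤ (t * ‖v.1‖) ^ 2 :=
      pow_le_pow_left₀ infDist_nonneg hdist 2
    nlinarith [mul_lt_mul_of_pos_left ht htI.1]
  · push Not at hex
    filter_upwards [self_mem_nhdsWithin] with t ht
    by_contra hne
    exact (mem_region_of_graphBump_ne_zero hne).1.not_ge (hex t ht)

theorem eventually_graphBump_eq_zero (hconv : ConvexOn ℝ univ f)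
    (hd : infDist p.1 N = 0) (hp : p.2 = f p.1) (v : E × ℝ) :
    ∀ᶠ t : ℝ in 𝓝 0, graphBump f N (p + t • v) = 0 := by
  have h0 : graphBump f N p = 0 := by simp [graphBump, hp]
  have hr := eventually_nhdsWithin_iff.1 (eventually_graphBump_eq_zero_right hconv hd hp v)
  have hl := eventually_nhdsWithin_iff.1 (eventually_graphBump_eq_zero_right hconv hd hp (-v))
  have hl' := (show Tendsto (fun t : ℝ => -t) (𝓝 0) (𝓝 0) by
    simpa using (continuous_neg (G := ℝ)).tendsto 0).eventually hl
  filter_upwards [hr, hl'] with t h1 h2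
  rcases lt_trichotomy t 0 with ht | rfl | ht
  · simpa using h2 (neg_pos.2 ht)
  · simpa using h0
  · exact h1 ht

theorem linearlyContinuous_graphBump (hf : Continuous f) (hconv : ConvexOn ℝ univ f) :
    LinearlyContinuous (graphBump f N) := by
  intro a v
  rw [continuous_iff_continuousAt]
  intro t₀
  by_cases h : infDist (a + t₀ • v).1 N = 0 ∧ (a + t₀ • v).2 = f (a + t₀ • v).1
  · have ht : Tendsto (fun t : ℝ => t - t₀) (𝓝 t₀) (𝓝 0) := by
      simpa using (continuous_sub_right t₀).tendsto t₀
    have hz : (fun t : ℝ => graphBump f N (a + t • v)) =ᶠ[𝓝 t₀] fun _ => 0 := by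
      filter_upwards [ht.eventually (eventually_graphBump_eq_zero hconv h.1 h.2 v)] with t ht
      rwa [add_assoc, ← add_smul, add_sub_cancel] at ht
    exact continuousAt_const.congr hz.symm
  · have hg : ContinuousAt (graphBump f N) (a + t₀ • v) :=
      graphBump_continuousAt hf (not_and_or.1 h)
    exact ContinuousAt.comp (f := fun t : ℝ => a + t • v) hg (by fun_prop)

end graphBump

theorem IsNowhereDense.preimage_homeomorph {X Y : Type*} [TopologicalSpace X] [TopologicalSpace Y]
    {s : Set Y} (hs : IsNowhereDense s) (e : X ≃ₜ Y) : IsNowhereDense (e ⁻¹' s) := by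
  rw [IsNowhereDense, ← e.preimage_closure, ← e.preimage_interior, hs, preimage_empty]

/-- The domain of a continuous function is homeomorphic to its graph. -/
def Homeomorph.toGraph {X Y : Type*} [TopologicalSpace X] [TopologicalSpace Y] {f : X → Y}
    (hf : Continuous f) : X ≃ₜ {p : X × Y | p.2 = f p.1} where
  toFun x := ⟨(x, f x), rfl⟩
  invFun p := p.1.1
  left_inv _ := rfl
  right_inv p := Subtype.ext (Prod.ext rfl p.2.symm)
  continuous_toFun := by fun_prop
  continuous_invFun := by fun_prop

theorem stmt_14 (n : ℕ) (hn : 2 ≤ n)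
    (f : EuclideanSpace ℝ (Fin (n - 1)) → ℝ) (hconv : ConvexOn ℝ Set.univ f)
    (M : Set (EuclideanSpace ℝ (Fin (n - 1)) × ℝ))
    (hM : M ⊆ {p : EuclideanSpace ℝ (Fin (n - 1)) × ℝ | p.2 = f p.1})
    (hnd : IsNowhereDense
      ((Subtype.val ⁻¹' M) :
        Set {p : EuclideanSpace ℝ (Fin (n - 1)) × ℝ | p.2 = f p.1})) :
    ∃ g : EuclideanSpace ℝ (Fin (n - 1)) × ℝ → ℝ,
      LinearlyContinuous g ∧ M ⊆ {p | ¬ ContinuousAt g p} := by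
  have hf : Continuous f := continuousOn_univ.1 (hconv.continuousOn isOpen_univ)
  have hN := hnd.preimage_homeomorph (Homeomorph.toGraph hf)
  refine ⟨graphBump f {x | (x, f x) ∈ M}, linearlyContinuous_graphBump hf hconv, fun p hp => ?_⟩
  obtain ⟨x, y⟩ := p
  obtain rfl : y = f x := hM hp
  exact not_continuousAt_graphBump hf hN hp
end
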